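/- arXiv:2507.19019 — 12 statements merged into one kernel-verified Lean document; each statement's English description precedes it below -/
import Mathlib

section
/- Every Artinian S-module is Artinian as an R-module. More precisely: if the R-module S/mS has finite length, then for every S-module B that is Artinian over S, the module B regarded as an R-module by restriction of scalars along φ is Artinian over R. -/
open IsLocalRing TensorProduct

/-- A power-torsion module over `x` whose `x`-torsion is Artinian is Artinian. -/
theorem isArtinian_of_isArtinian_torsionBy {R M : Type*} [CommRing R] [AddCommGroup M]
    [Module R M] (x : R) (hx : ∀ b : M, ∃ k : ℕ, x ^ k • b = 0)
    [IsArtinian R (Submodule.torsionBy R M x)] : IsArtinian R M := by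
  rw [← monotone_stabilizes_iff_artinian]
  intro f
  let N : ℕ → Submodule R M := fun i => OrderDual.ofDual (f i)
  have hN : Antitone N := fun i j h => f.monotone h
  let g : ℕ → ℕ → Submodule R (Submodule.torsionBy R M x) := fun i j =>
    ((N i).map (LinearMap.lsmul R M (x ^ j))).comap (Submodule.subtype _)
  have mem_g (i j : ℕ) (b : Submodule.torsionBy R M x) :
      b ∈ g i j ↔ ∃ c ∈ N i, x ^ j • c = b := by
    simp [g]
  have hg {i i' j j' : ℕ} (hi : i ≤ i') (hj : j ≤ j') : g i' j' ≤ g i j := by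
    intro b hb
    obtain ⟨c, hc, hcb⟩ := (mem_g _ _ _).1 hb
    refine (mem_g _ _ _).2 ⟨x ^ (j' - j) • c, (N i).smul_mem _ (hN hi hc), ?_⟩
    rw [smul_smul, ← pow_add, Nat.add_sub_cancel' hj, hcb]
  obtain ⟨n, hn⟩ := IsArtinian.monotone_stabilizes
    (⟨fun i => OrderDual.toDual (g i i), fun i j h => hg h h⟩ :
      ℕ →o (Submodule R (Submodule.torsionBy R M x))ᵒᵈ)
  have hrow (j : ℕ) : ∃ k, ∀ i, k ≤ i → g k j = g i j :=
    IsArtinian.monotone_stabilizes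
      (⟨fun i => OrderDual.toDual (g i j), fun i i' h => hg h le_rfl⟩ :
        ℕ →o (Submodule R (Submodule.torsionBy R M x))ᵒᵈ)
  choose k hk using hrow
  let K := max n ((Finset.range n).sup k)
  have hK (i j : ℕ) (hi : K ≤ i) : g K j ≤ g i j := by
    rcases lt_or_ge j n with hj | hj
    · have hkK : k j ≤ K := (Finset.le_sup (Finset.mem_range.2 hj)).trans (le_max_right _ _)
      rw [← hk j K hkK, ← hk j i (hkK.trans hi)]
    · have hnK : n ≤ K := le_max_left _ _
      calc g K j ≤ g n n := hg hnK hj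
        _ = g (max i j) (max i j) := hn _ (hj.trans (le_max_right _ _))
        _ ≤ g i j := hg (le_max_left _ _) (le_max_right _ _)
  refine ⟨K, fun i hi => le_antisymm (f.monotone hi) ?_⟩
  change N K ≤ N i
  have key (j : ℕ) : ∀ b ∈ N K, x ^ j • b = 0 → b ∈ N i := by
    induction j with
    | zero => intro b _ h; simp_all
    | succ j ih =>
      intro b hb h
      have hmem : x ^ j • b ∈ Submodule.torsionBy R M x := by
        rwa [Submodule.mem_torsionBy_iff, smul_smul, ← pow_succ']
      obtain ⟨c, hc, hcb⟩ := (mem_g _ _ _).1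
        (hK i j hi ((mem_g K j ⟨_, hmem⟩).2 ⟨b, hb, rfl⟩))
      have := ih (b - c) (sub_mem hb (hN hi hc)) (by rw [smul_sub, hcb, sub_self])
      simpa using add_mem this hc
  intro b hb
  obtain ⟨j, hj⟩ := hx b
  exact key j b hb hj

theorem isArtinian_of_isArtinian_torsionBySet {R M : Type*} [CommRing R] [AddCommGroup M]
    [Module R M] (s : Finset R) (hs : ∀ x ∈ s, ∀ b : M, ∃ k : ℕ, x ^ k • b = 0)
    (h : IsArtinian R (Submodule.torsionBySet R M (s : Set R))) : IsArtinian R M := by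
  classical
  induction s using Finset.induction_on with
  | empty =>
    refine isArtinian_of_injective
      ((LinearMap.id : M →ₗ[R] M).codRestrict
        (Submodule.torsionBySet R M ((∅ : Finset R) : Set R)) ?_) ?_
    · simp
    · exact fun a b hab => congrArg Subtype.val hab
  | insert x s _ ih =>
    refine ih (fun y hy => hs y (Finset.mem_insert_of_mem hy)) ?_
    have : IsArtinian R
        (Submodule.torsionBy R (Submodule.torsionBySet R M (s : Set R)) x) := by
      refine isArtinian_of_injective
        (((Submodule.subtype _).comp (Submodule.subtype _)).codRestrict
          (Submodule.torsionBySet R M ((insert x s : Finset R) : Set R)) ?_) ?_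
      · rintro ⟨⟨b, hb⟩, hxb⟩
        rw [Submodule.mem_torsionBySet_iff] at hb ⊢
        rintro ⟨y, hy⟩
        rcases Finset.mem_insert.1 (Finset.mem_coe.1 hy) with rfl | hy
        · exact congrArg Subtype.val ((Submodule.mem_torsionBy_iff _ _).1 hxb)
        · exact hb ⟨y, hy⟩
      · intro a b hab
        have h := congrArg Subtype.val hab
        exact Subtype.ext (Subtype.ext h)
    refine isArtinian_of_isArtinian_torsionBy x fun b => ?_
    obtain ⟨k, hk⟩ := hs x (Finset.mem_insert_self _ _) b
    exact ⟨k, Subtype.ext hk⟩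

theorem IsArtinian.exists_pow_smul_eq_zero {S M : Type*} [CommRing S] [IsLocalRing S]
    [AddCommGroup M] [Module S M] [IsArtinian S M] {x : S} (hx : x ∈ maximalIdeal S) (b : M) :
    ∃ k : ℕ, x ^ k • b = 0 := by
  obtain ⟨k, c, hc⟩ := IsArtinian.exists_pow_succ_smul_dvd x
    (⟨b, Submodule.mem_span_singleton_self b⟩ : Submodule.span S {b})
  obtain ⟨t, ht⟩ := Submodule.mem_span_singleton.1 c.2
  have hc' : x ^ (k + 1) • (c : M) = x ^ k • b := congrArg Subtype.val hc
  have hu : IsUnit (1 - x * t) := by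
    by_contra h
    have h1 : 1 - x * t ∈ maximalIdeal S := (mem_maximalIdeal _).2 h
    have := add_mem h1 (Ideal.mul_mem_right t _ hx)
    exact (Ideal.ne_top_iff_one _).1 (maximalIdeal.isMaximal S).ne_top
      (by simpa only [sub_add_cancel] using this)
  refine ⟨k, hu.smul_eq_zero.1 ?_⟩
  rw [smul_smul, sub_mul, sub_smul, one_mul, sub_eq_zero, ← hc', ← ht, smul_smul]
  congr 1
  ring

/-- The `I`-torsion of an Artinian `S`-module is Artinian over `R` if `S ⧸ I` is. -/
theorem isArtinian_torsionBySet_of_isArtinian_quotient (R : Type*) {S : Type*} (M : Type*)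
    [CommRing R] [CommRing S] [Algebra R S] [AddCommGroup M] [Module R M] [Module S M]
    [IsScalarTower R S M] [IsArtinian S M] (I : Ideal S) [IsArtinian R (S ⧸ I)] :
    IsArtinian R (Submodule.torsionBySet S M (I : Set S)) := by
  have : IsArtinianRing (S ⧸ I) := isArtinian_of_tower R inferInstance
  have : IsArtinian (S ⧸ I) (Submodule.torsionBySet S M (I : Set S)) :=
    isArtinian_of_tower S inferInstance
  have : IsNoetherian (S ⧸ I) (Submodule.torsionBySet S M (I : Set S)) :=
    IsSemiprimaryRing.isNoetherian_iff_isArtinian.2 this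
  have : IsScalarTower R (S ⧸ I) (Submodule.torsionBySet S M (I : Set S)) := by
    refine ⟨fun r q m => ?_⟩
    obtain ⟨s, rfl⟩ := Ideal.Quotient.mk_surjective q
    exact smul_assoc r s m
  obtain ⟨n, f, hf⟩ :=
    Module.Finite.exists_fin' (S ⧸ I) (Submodule.torsionBySet S M (I : Set S))
  exact isArtinian_of_surjective _ (f.restrictScalars R) hf

theorem isArtinian_restrictScalars (R : Type*) {S M : Type*} [CommRing R] [CommRing S]
    [IsNoetherianRing R] [IsLocalRing R] [IsLocalRing S] [Algebra R S]
    [IsLocalHom (algebraMap R S)] [AddCommGroup M] [Module R M] [Module S M]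
    [IsScalarTower R S M] [IsArtinian S M]
    [IsArtinian R (S ⧸ (maximalIdeal R).map (algebraMap R S))] : IsArtinian R M := by
  obtain ⟨s, hs⟩ := (isNoetherianRing_iff_ideal_fg R).1 inferInstance (maximalIdeal R)
  refine isArtinian_of_isArtinian_torsionBySet s (fun x hx b => ?_) ?_
  · have hxm : x ∈ maximalIdeal R := hs ▸ Ideal.subset_span hx
    obtain ⟨k, hk⟩ := IsArtinian.exists_pow_smul_eq_zero
      (show algebraMap R S x ∈ maximalIdeal S from
        fun h => hxm (isUnit_of_map_unit (algebraMap R S) x h)) b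
    exact ⟨k, by rwa [← map_pow, algebraMap_smul] at hk⟩
  · have : IsArtinian R ((Submodule.torsionBySet S M
        ((maximalIdeal R).map (algebraMap R S) : Set S)).restrictScalars R) :=
      isArtinian_torsionBySet_of_isArtinian_quotient R M ((maximalIdeal R).map (algebraMap R S))
    refine isArtinian_of_injective
      (LinearMap.codRestrict
        (Submodule.torsionBySet S M ((maximalIdeal R).map (algebraMap R S) : Set S)
          |>.restrictScalars R)
        (Submodule.subtype (Submodule.torsionBySet R M (s : Set R))) ?_) ?_
    · rintro ⟨b, hb⟩
      rw [Submodule.mem_torsionBySet_iff] at hb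
      rw [Submodule.restrictScalars_mem, ← hs, Ideal.map_span,
        ← Submodule.torsionBySet_eq_torsionBySet_span, Submodule.mem_torsionBySet_iff]
      rintro ⟨_, r, hr, rfl⟩
      exact (algebraMap_smul S r b).trans (hb ⟨r, hr⟩)
    · intro a b hab
      have h := congrArg Subtype.val hab
      exact Subtype.ext h

/-- If the `R`-module `S/mS` has finite length, then every Artinian `S`-module is
Artinian as an `R`-module by restriction of scalars along the flat local map `R → S`. -/
theorem stmt0 (R S : Type*) [CommRing R] [CommRing S] [IsNoetherianRing R] [IsNoetherianRing S]
    [IsLocalRing R] [IsLocalRing S] [Algebra R S] [Module.Flat R S]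
    [IsLocalHom (algebraMap R S)]
    (hfl : IsFiniteLength R (S ⧸ (maximalIdeal R).map (algebraMap R S)))
    (B : Type*) [AddCommGroup B] [Module S B] [IsArtinian S B] :
    IsArtinian R (RestrictScalars R S B) := by
  have := (isFiniteLength_iff_isNoetherian_isArtinian.1 hfl).2
  let : Module R B := Module.restrictScalars R S B
  have : IsScalarTower R S B := IsScalarTower.restrictScalars R S B
  exact (isArtinian_restrictScalars R (S := S) : IsArtinian R B)
end

section
/- If E is an injective S-module containing an essential copy of the residue field S/n (that is, there is an injective S-linear map ι : S/n → E whose image meets every nonzero S-submodule of E nontrivially), and if E is Artinian as an R-module by restriction of scalars along φ, then the R-module S/mS has finite length. -/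
open IsLocalRing TensorProduct

universe u v w x

theorem Module.Injective.exists_extension_of_small {S : Type u} [Ring S] {E : Type v}
    [AddCommGroup E] [Module S E] (hE : Module.Injective S E) {X : Type w} {Y : Type x}
    [AddCommGroup X] [Module S X] [AddCommGroup Y] [Module S Y] [Small.{v} Y]
    (f : X →ₗ[S] Y) (hf : Function.Injective f) (g : X →ₗ[S] E) :
    ∃ h : Y →ₗ[S] E, ∀ x, h (f x) = g x := by
  have : Small.{v} X := small_of_injective hf
  let eX := Shrink.linearEquiv.{v} S X
  let eY := Shrink.linearEquiv.{v} S Y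
  obtain ⟨h, hh⟩ := hE.out (eY.symm.toLinearMap ∘ₗ f ∘ₗ eX.toLinearMap)
    (eY.symm.injective.comp (hf.comp eX.injective)) (g ∘ₗ eX.toLinearMap)
  refine ⟨h ∘ₗ eY.symm.toLinearMap, fun x ↦ ?_⟩
  simpa using hh (eX.symm x)

theorem IsFiniteLength.small {S : Type u} [CommRing S] [IsLocalRing S]
    [Small.{v} (S ⧸ maximalIdeal S)] {M : Type w} [AddCommGroup M] [Module S M]
    (h : IsFiniteLength S M) : Small.{v} M := by
  induction h with
  | of_subsingleton => infer_instance
  | @of_simple_quotient M _ _ N hN _ ih =>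
    obtain ⟨I, hI, ⟨e⟩⟩ := isSimpleModule_iff_quot_maximal.mp hN
    obtain rfl := IsLocalRing.eq_maximalIdeal hI
    have : Small.{v} (M ⧸ N) := small_map e.toEquiv
    have : Small.{v} (M ⧸ N.toAddSubgroup) := this
    have : Small.{v} N.toAddSubgroup := ih
    exact small_map (AddSubgroup.addGroupEquivQuotientProdAddSubgroup (s := N.toAddSubgroup))

theorem IsLocalRing.isFiniteLength_quotient_of_maximalIdeal_pow_le {S : Type u} [CommRing S]
    [IsNoetherianRing S] [IsLocalRing S] (J : Ideal S) (n : ℕ) (hJ : maximalIdeal S ^ n ≤ J) :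
    IsFiniteLength S (S ⧸ J) := by
  have : Ring.KrullDimLE 0 (S ⧸ J) := Ring.krullDimLE_zero_iff.mpr fun P prime ↦
    Ideal.isMaximal_of_isIntegral_of_isMaximal_comap _ <| by
      have hP := prime.comap (Ideal.Quotient.mk J)
      have hJP : J ≤ P.comap (Ideal.Quotient.mk J) := le_trans (by simp) (Ideal.ker_le_comap _)
      have : P.comap (Ideal.Quotient.mk J) = maximalIdeal S :=
        le_antisymm (le_maximalIdeal hP.1) (hP.le_of_pow_le (hJ.trans hJP))
      exact this ▸ maximalIdeal.isMaximal S
  have : IsArtinianRing (S ⧸ J) := IsNoetherianRing.isArtinianRing_of_krullDimLE_zero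
  exact isFiniteLength_iff_isNoetherian_isArtinian.mpr ⟨inferInstance,
    isArtinian_of_surjective_algebraMap (Ideal.Quotient.mk_surjective (I := J))⟩

theorem IsLocalRing.exists_notMem_sup_maximalIdeal_pow {S : Type u} [CommRing S]
    [IsNoetherianRing S] [IsLocalRing S] (I : Ideal S) {a : S} (ha : a ∉ I) :
    ∃ n : ℕ, a ∉ I ⊔ maximalIdeal S ^ n := by
  by_contra! h
  apply ha
  rw [← Ideal.Quotient.eq_zero_iff_mem, ← Submodule.mem_bot S,
    ← Ideal.iInf_pow_smul_eq_bot_of_isLocalRing (M := S ⧸ I) (maximalIdeal S)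
      (maximalIdeal.isMaximal S).ne_top, Submodule.mem_iInf]
  intro n
  obtain ⟨i, hi, b, hb, rfl⟩ := Submodule.mem_sup.mp (h n)
  rw [map_add, Ideal.Quotient.eq_zero_iff_mem.mpr hi, zero_add]
  have : Ideal.Quotient.mk I b = b • (1 : S ⧸ I) := by simp [Algebra.smul_def]
  rw [this]
  exact Submodule.smul_mem_smul hb trivial

/-- An injective module containing the residue field detects membership in every ideal `I`: the
submodule of elements of `E` killed by `I` has annihilator exactly `I`. -/
theorem Module.Injective.exists_smul_ne_zero_of_notMem {S : Type u} [CommRing S]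
    [IsNoetherianRing S] [IsLocalRing S] {E : Type v} [AddCommGroup E] [Module S E]
    (hE : Module.Injective S E) (ι : (S ⧸ maximalIdeal S) →ₗ[S] E) (hι : Function.Injective ι)
    (I : Ideal S) {a : S} (ha : a ∉ I) : ∃ e : E, (∀ s ∈ I, s • e = 0) ∧ a • e ≠ 0 := by
  have : Small.{v} (S ⧸ maximalIdeal S) := small_of_injective hι
  obtain ⟨n, hn⟩ := IsLocalRing.exists_notMem_sup_maximalIdeal_pow I ha
  set J := I ⊔ maximalIdeal S ^ n
  have : Small.{v} (S ⧸ J) :=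
    (isFiniteLength_quotient_of_maximalIdeal_pow_le J n le_sup_right).small
  let f : S →ₗ[S] S ⧸ J := LinearMap.toSpanSingleton S (S ⧸ J) (Ideal.Quotient.mk J a)
  have hker : LinearMap.ker f ≤ maximalIdeal S := by
    refine le_maximalIdeal fun htop ↦ hn ?_
    have h1 : f 1 = 0 := LinearMap.mem_ker.mp (htop ▸ trivial)
    rw [LinearMap.toSpanSingleton_apply, one_smul] at h1
    exact Ideal.Quotient.eq_zero_iff_mem.mp h1
  obtain ⟨h, hh⟩ := hE.exists_extension_of_small ((LinearMap.ker f).liftQ f le_rfl)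
    (LinearMap.ker_eq_bot.mp (Submodule.ker_liftQ_eq_bot _ _ _ le_rfl))
    (ι ∘ₗ Submodule.factor hker)
  have hsmul (s : S) : s • h 1 = h (Ideal.Quotient.mk J s) := by
    rw [← map_smul, Algebra.smul_def, mul_one]; rfl
  refine ⟨h 1, fun s hs ↦ ?_, fun h0 ↦ ?_⟩
  · rw [hsmul, Ideal.Quotient.eq_zero_iff_mem.mpr (Ideal.mem_sup_left hs), map_zero]
  · have h1 := hh (Submodule.Quotient.mk 1)
    rw [Submodule.liftQ_apply, LinearMap.toSpanSingleton_apply, one_smul, ← hsmul, h0] at h1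
    have h2 := (map_eq_zero_iff ι hι).mp h1.symm
    exact (Ideal.ne_top_iff_one _).mp (maximalIdeal.isMaximal S).ne_top
      (Ideal.Quotient.eq_zero_iff_mem.mp h2)

theorem IsLocalRing.isFiniteLength_of_isArtinian_of_isTorsionBySet_maximalIdeal {R : Type u}
    [CommRing R] [IsLocalRing R] {M : Type v} [AddCommGroup M] [Module R M] [IsArtinian R M]
    (hM : Module.IsTorsionBySet R M (maximalIdeal R)) : IsFiniteLength R M := by
  let := hM.module
  let : Field (R ⧸ maximalIdeal R) := Ideal.Quotient.field _
  have : IsSemisimpleModule R M := hM.isSemisimpleModule_iff.mp inferInstance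
  exact (IsSemisimpleModule.finite_tfae (R := R) (M := M).out 2 3).mp ‹_›

theorem IsFiniteLength.quotient_annihilator {R : Type w} {S : Type u} [CommRing R] [CommRing S]
    [Algebra R S] {T : Type v} [AddCommGroup T] [Module S T] [Module R T] [IsScalarTower R S T]
    (hT : IsFiniteLength R T) : IsFiniteLength R (S ⧸ Module.annihilator S T) := by
  obtain ⟨_, _⟩ := isFiniteLength_iff_isNoetherian_isArtinian.mp hT
  obtain ⟨m, t, ht⟩ := Module.Finite.exists_fin (R := R) (M := T)
  let F : S →ₗ[S] (Fin m → T) := LinearMap.toSpanSingleton S _ t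
  have hF : Module.annihilator S T ≤ LinearMap.ker F := fun s hs ↦
    funext fun i ↦ Module.mem_annihilator.mp hs (t i)
  have hF' : LinearMap.ker F ≤ Module.annihilator S T := fun s hs ↦ by
    refine Module.mem_annihilator.mpr fun e ↦ ?_
    have : e ∈ Submodule.span R (Set.range t) := ht ▸ trivial
    induction this using Submodule.span_induction with
    | mem x hx =>
      obtain ⟨i, rfl⟩ := hx
      exact congrFun (LinearMap.mem_ker.mp hs) i
    | zero => exact smul_zero s
    | add x y _ _ hx hy => rw [smul_add, hx, hy, add_zero]
    | smul r x _ hx => rw [← algebraMap_smul S r x, smul_comm, hx, smul_zero]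
  let G : (S ⧸ Module.annihilator S T) →ₗ[S] (Fin m → T) :=
    (Module.annihilator S T).liftQ F hF
  have hG : Function.Injective (G.restrictScalars R) :=
    LinearMap.ker_eq_bot (f := G).mp (Submodule.ker_liftQ_eq_bot _ F hF hF')
  have hfin : IsFiniteLength R (Fin m → T) :=
    isFiniteLength_iff_isNoetherian_isArtinian.mpr ⟨inferInstance, inferInstance⟩
  exact hfin.of_injective hG

theorem Module.Injective.annihilator_torsionBySet {S : Type u} [CommRing S]
    [IsNoetherianRing S] [IsLocalRing S] {E : Type v} [AddCommGroup E] [Module S E]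
    (hE : Module.Injective S E) (ι : (S ⧸ maximalIdeal S) →ₗ[S] E) (hι : Function.Injective ι)
    (I : Ideal S) : Module.annihilator S (Submodule.torsionBySet S E I) = I := by
  ext a
  rw [Module.mem_annihilator]
  refine ⟨fun h ↦ ?_, fun ha e ↦
    Subtype.ext ((Submodule.mem_torsionBySet_iff _ _).mp e.2 ⟨a, ha⟩)⟩
  by_contra ha
  obtain ⟨e, he, hae⟩ := hE.exists_smul_ne_zero_of_notMem ι hι I ha
  exact hae (congrArg Subtype.val
    (h ⟨e, (Submodule.mem_torsionBySet_iff _ _).mpr fun b ↦ he b b.2⟩))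

theorem isFiniteLength_quotient_map_maximalIdeal_of_isArtinian {R : Type w} {S : Type u}
    [CommRing R] [CommRing S] [IsNoetherianRing S] [IsLocalRing R] [IsLocalRing S] [Algebra R S]
    {E : Type v} [AddCommGroup E] [Module S E] [Module R E] [IsScalarTower R S E]
    (hE : Module.Injective S E) (ι : (S ⧸ maximalIdeal S) →ₗ[S] E) (hι : Function.Injective ι)
    [IsArtinian R E] :
    IsFiniteLength R (S ⧸ (maximalIdeal R).map (algebraMap R S)) := by
  have hann := hE.annihilator_torsionBySet ι hι ((maximalIdeal R).map (algebraMap R S))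
  generalize hT : Submodule.torsionBySet S E ((maximalIdeal R).map (algebraMap R S)) = T at hann
  have : IsArtinian R T :=
    isArtinian_of_injective (T.subtype.restrictScalars R) T.injective_subtype
  have htors : Module.IsTorsionBySet R T (maximalIdeal R) := fun e r ↦ by
    rw [← algebraMap_smul S (r : R) e]
    exact Module.mem_annihilator.mp (hann ▸ Ideal.mem_map_of_mem _ r.2) e
  rw [← hann]
  exact (isFiniteLength_of_isArtinian_of_isTorsionBySet_maximalIdeal htors).quotient_annihilator

/-- If `E` is an injective `S`-module containing an essential copy of the residue field `S/n`,
and `E` is Artinian as an `R`-module by restriction of scalars along the flat local map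
`R → S`, then the `R`-module `S/mS` has finite length. -/
theorem stmt1 (R S : Type*) [CommRing R] [CommRing S] [IsNoetherianRing R] [IsNoetherianRing S]
    [IsLocalRing R] [IsLocalRing S] [Algebra R S] [Module.Flat R S]
    [IsLocalHom (algebraMap R S)]
    (E : Type*) [AddCommGroup E] [Module S E] (hE : Module.Injective S E)
    (ι : (S ⧸ maximalIdeal S) →ₗ[S] E) (hι : Function.Injective ι)
    (hess : ∀ N : Submodule S E, N ≠ ⊥ → LinearMap.range ι ⊓ N ≠ ⊥)
    (hart : IsArtinian R (RestrictScalars R S E)) :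
    IsFiniteLength R (S ⧸ (maximalIdeal R).map (algebraMap R S)) := by
  let : Module R E := Module.restrictScalars R S E
  have : IsScalarTower R S E := IsScalarTower.restrictScalars R S E
  have : IsArtinian R E := hart
  exact isFiniteLength_quotient_map_maximalIdeal_of_isArtinian hE ι hι
end

section
/- Suppose the R-module S/mS has finite length m (a natural number). Then for every Artinian R-module A there is an R-linear isomorphism A ⊗_R S ≅ A^m (the direct sum of m copies of A), where A ⊗_R S is regarded as an R-module in the natural way. -/
open IsLocalRing TensorProduct CategoryTheory

/-- The length of a module, as the Krull dimension of its lattice of submodules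
(the supremum of lengths of strictly increasing chains of submodules). -/
noncomputable def moduleLength (R M : Type*) [Semiring R] [AddCommMonoid M] [Module R M] :
    WithBot ℕ∞ :=
  Order.krullDim (Submodule R M)

/-- The linear map `(aᵢ) ↦ ∑ aᵢ ⊗ sᵢ`. -/
noncomputable def sumTmul (R A : Type*) {S ι : Type*} [CommRing R] [AddCommGroup A]
    [Module R A] [AddCommGroup S] [Module R S] [Fintype ι] (s : ι → S) :
    (ι → A) →ₗ[R] A ⊗[R] S :=
  ∑ i, (TensorProduct.mk R A S).flip (s i) ∘ₗ LinearMap.proj i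

theorem sumTmul_apply {R A S ι : Type*} [CommRing R] [AddCommGroup A] [Module R A]
    [AddCommGroup S] [Module R S] [Fintype ι] (s : ι → S) (a : ι → A) :
    sumTmul R A s a = ∑ i, a i ⊗ₜ[R] s i := by
  simp [sumTmul]

section

variable {R : Type*} [CommRing R] [IsLocalRing R]

/-- Over a Noetherian local ring, every element of an Artinian module is annihilated by a power of
the maximal ideal. -/
theorem exists_maximalIdeal_pow_smul_eq_zero [IsNoetherianRing R] {A : Type*} [AddCommGroup A]
    [Module R A] [IsArtinian R A] (a : A) :
    ∃ n : ℕ, ∀ r ∈ maximalIdeal R ^ n, r • a = 0 := by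
  let f : ℕ →o (Submodule R A)ᵒᵈ :=
    ⟨fun n ↦ OrderDual.toDual (maximalIdeal R ^ n • Submodule.span R {a}),
      fun _ _ h ↦ Submodule.smul_mono_left (Ideal.pow_le_pow_right h)⟩
  obtain ⟨n, hn⟩ := IsArtinian.monotone_stabilizes f
  have hn : maximalIdeal R ^ n • Submodule.span R {a} =
      maximalIdeal R ^ (n + 1) • Submodule.span R {a} := hn (n + 1) n.le_succ
  have hfg : (maximalIdeal R ^ n • Submodule.span R {a}).FG :=
    Submodule.FG.smul (IsNoetherian.noetherian _) (Submodule.fg_span_singleton a)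
  have hbot : maximalIdeal R ^ n • Submodule.span R {a} = ⊥ := by
    refine Submodule.eq_bot_of_le_smul_of_le_jacobson_bot (maximalIdeal R) _ hfg ?_
      (maximalIdeal_le_jacobson ⊥)
    rw [← mul_smul, ← pow_succ', ← hn]
  refine ⟨n, fun r hr ↦ ?_⟩
  rw [← Submodule.mem_bot R, ← hbot]
  exact Submodule.smul_mem_smul hr (Submodule.mem_span_singleton_self a)

/-- A nonzero submodule of an Artinian module over a Noetherian local ring contains a nonzero
element annihilated by the maximal ideal. -/
theorem exists_mem_ne_zero_maximalIdeal_smul_eq_zero {M : Type*} [AddCommGroup M] [Module R M]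
    [IsArtinian R M] {N : Submodule R M} (hN : N ≠ ⊥) :
    ∃ x ∈ N, x ≠ 0 ∧ ∀ r ∈ maximalIdeal R, r • x = 0 := by
  obtain ⟨P, hP, hPN⟩ := (eq_bot_or_exists_atom_le N).resolve_left hN
  have : IsSimpleModule R P := isSimpleModule_iff_isAtom.mpr hP
  obtain ⟨x, hx, hx0⟩ := Submodule.exists_mem_ne_zero_of_ne_bot hP.1
  have hann : Module.annihilator R P = maximalIdeal R :=
    eq_maximalIdeal (IsSimpleModule.annihilator_isMaximal (R := R) (M := P))
  refine ⟨x, hPN hx, hx0, fun r hr ↦ ?_⟩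
  rw [← hann, Module.mem_annihilator] at hr
  exact congrArg Subtype.val (hr ⟨x, hx⟩)

/-- An element annihilated by the maximal ideal is detected by a linear functional with values in
the residue field, defined on the submodule of all such elements. -/
theorem exists_linearMap_residueField_ne_zero {A : Type*} [AddCommGroup A] [Module R A]
    (a : Submodule.torsionBySet R A (maximalIdeal R)) (ha : a ≠ 0) :
    ∃ l : Submodule.torsionBySet R A (maximalIdeal R) →ₗ[R] ResidueField R, l a ≠ 0 := by
  let : Field (R ⧸ maximalIdeal R) := Ideal.Quotient.field _
  by_contra! h
  exact ha ((Module.forall_dual_apply_eq_zero_iff (R ⧸ maximalIdeal R) a).mp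
    fun l ↦ h (l.restrictScalars R))

variable {S : Type*} [AddCommGroup S] [Module R S] {ι : Type*} [Fintype ι]

theorem sumTmul_injective [Module.Flat R S] (A : Type*) [AddCommGroup A] [Module R A]
    [IsArtinian R A] {s : ι → S}
    (hs : LinearIndependent (ResidueField R) fun i ↦ (1 : ResidueField R) ⊗ₜ[R] s i) :
    Function.Injective (sumTmul R A s) := by
  rw [← LinearMap.ker_eq_bot]
  by_contra hker
  obtain ⟨x, hx, hx0, hmx⟩ := exists_mem_ne_zero_maximalIdeal_smul_eq_zero hker
  obtain ⟨j, hj⟩ := Function.ne_iff.mp hx0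
  let y (i : ι) : Submodule.torsionBySet R A (maximalIdeal R) :=
    ⟨x i, (Submodule.mem_torsionBySet_iff _ _).mpr fun r ↦ congrFun (hmx r r.2) i⟩
  obtain ⟨l, hl⟩ := exists_linearMap_residueField_ne_zero (y j)
    fun h ↦ hj (congrArg Subtype.val h)
  have hy : ∑ i, y i ⊗ₜ[R] s i = 0 := by
    apply Module.Flat.rTensor_preserves_injective_linearMap (M := S)
      (Submodule.torsionBySet R A (maximalIdeal R)).subtype (Submodule.subtype_injective _)
    rw [LinearMap.mem_ker, sumTmul_apply] at hx
    simpa [y] using hx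
  have hly := congrArg (l.rTensor S) hy
  simp only [map_sum, LinearMap.rTensor_tmul, map_zero] at hly
  refine hl (Fintype.linearIndependent_iff.mp hs (fun i ↦ l (y i)) ?_ j)
  simpa [TensorProduct.smul_tmul'] using hly

theorem sumTmul_surjective [IsNoetherianRing R] (A : Type*) [AddCommGroup A] [Module R A]
    [IsArtinian R A] {s : ι → S}
    (hs : Submodule.span R (Set.range s) ⊔ maximalIdeal R • (⊤ : Submodule R S) = ⊤) :
    Function.Surjective (sumTmul R A s) := by
  classical
  have hpow (n : ℕ) :
      Submodule.span R (Set.range s) ⊔ maximalIdeal R ^ n • (⊤ : Submodule R S) = ⊤ := by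
    induction n with
    | zero => simp
    | succ n ih =>
      rw [eq_top_iff]
      nth_rw 1 [← ih, ← hs]
      rw [Submodule.smul_sup, ← mul_smul, ← pow_succ]
      exact sup_le le_sup_left
        (sup_le (Submodule.smul_le_right.trans le_sup_left) le_sup_right)
  rw [← LinearMap.range_eq_top, eq_top_iff, ← TensorProduct.span_tmul_eq_top, Submodule.span_le]
  rintro _ ⟨a, t, rfl⟩
  obtain ⟨n, hn⟩ := exists_maximalIdeal_pow_smul_eq_zero (R := R) a
  suffices h : ⊤ ≤ (LinearMap.range (sumTmul R A s)).comap (TensorProduct.mk R A S a) from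
    h (Submodule.mem_top (x := t))
  rw [← hpow n]
  refine sup_le (Submodule.span_le.mpr ?_) (Submodule.smul_le.mpr fun r hr u _ ↦ ?_)
  · rintro _ ⟨i, rfl⟩
    refine ⟨Pi.single i a, ?_⟩
    rw [sumTmul_apply, Finset.sum_eq_single i]
    · simp
    · intro j _ hj
      simp [hj]
    · simp
  · simp only [Submodule.mem_comap, TensorProduct.mk_apply]
    rw [← TensorProduct.smul_tmul, hn r hr, TensorProduct.zero_tmul]
    exact zero_mem _

/-- If `M / 𝔪M` has finite length `m`, then it has a basis over the residue field consisting of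
the classes of `m` elements of `M`. -/
theorem exists_basis_residueField_tensor (m : ℕ)
    (h : Module.length R (S ⧸ maximalIdeal R • (⊤ : Submodule R S)) = m) :
    ∃ (s : Fin m → S) (b : Module.Basis (Fin m) (ResidueField R) (ResidueField R ⊗[R] S)),
      ∀ i, b i = 1 ⊗ₜ s i := by
  let e : (ResidueField R ⊗[R] S) ≃ₗ[R] S ⧸ maximalIdeal R • (⊤ : Submodule R S) :=
    TensorProduct.quotTensorEquivQuotSMul S (maximalIdeal R)
  have hlen : Module.length (ResidueField R) (ResidueField R ⊗[R] S) = m := by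
    rw [← h, ← e.length_eq, Module.length_eq_of_surjective (S := R) residue_surjective]
  have hrank : Module.rank (ResidueField R) (ResidueField R ⊗[R] S) = m := by
    rwa [Module.length_eq_rank, Cardinal.toENat_eq_natCast] at hlen
  have : Module.Finite (ResidueField R) (ResidueField R ⊗[R] S) :=
    Module.rank_lt_aleph0_iff.mp (hrank ▸ Cardinal.natCast_lt_aleph0)
  let b := Module.finBasisOfFinrankEq (ResidueField R) (ResidueField R ⊗[R] S)
    (Module.finrank_eq_of_rank_eq hrank)
  obtain ⟨s, hs⟩ :=
    (TensorProduct.mk_surjective R S (ResidueField R) residue_surjective).comp_left b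
  exact ⟨s, b, fun i ↦ (congrFun hs i).symm⟩

theorem span_sup_maximalIdeal_smul_top_eq_top {κ : Type*} {s : κ → S}
    (b : Module.Basis κ (ResidueField R) (ResidueField R ⊗[R] S)) (hb : ∀ i, b i = 1 ⊗ₜ s i) :
    Submodule.span R (Set.range s) ⊔ maximalIdeal R • (⊤ : Submodule R S) = ⊤ := by
  have hspan : Submodule.span R (Set.range b) = ⊤ := by
    have := Submodule.restrictScalars_span R (ResidueField R) residue_surjective (Set.range b)
    rw [← this, b.span_eq, Submodule.restrictScalars_top]
  have hmap : (Submodule.span R (Set.range s)).map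
      (TensorProduct.mk R (ResidueField R) S 1) = ⊤ := by
    rw [Submodule.map_span, ← Set.range_comp, ← hspan]
    congr 2
    exact funext fun i ↦ (hb i).symm
  have := congrArg (Submodule.comap (TensorProduct.mk R (ResidueField R) S 1)) hmap
  have hker : LinearMap.ker (TensorProduct.mk R (ResidueField R) S 1) =
      maximalIdeal R • (⊤ : Submodule R S) := LinearMap.ker_tensorProductMk S
  rwa [Submodule.comap_map_eq, Submodule.comap_top, hker] at this

end

/-- If the `R`-module `S/mS` has finite length `m`, then for every Artinian `R`-module `A`
there is an `R`-linear isomorphism `A ⊗_R S ≅ A^m`. -/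
theorem stmt3 (R S : Type*) [CommRing R] [CommRing S] [IsNoetherianRing R] [IsNoetherianRing S]
    [IsLocalRing R] [IsLocalRing S] [Algebra R S] [Module.Flat R S]
    [IsLocalHom (algebraMap R S)]
    (m : ℕ) (hlen : moduleLength R (S ⧸ (maximalIdeal R).map (algebraMap R S)) = (m : ℕ∞))
    (A : Type*) [AddCommGroup A] [Module R A] [IsArtinian R A] :
    Nonempty ((A ⊗[R] S) ≃ₗ[R] (Fin m → A)) := by
  have hlen' : Module.length R (S ⧸ maximalIdeal R • (⊤ : Submodule R S)) = m := by
    rw [Ideal.smul_top_eq_map, ← WithBot.coe_inj, ← hlen, moduleLength, ← Module.coe_length]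
    rfl
  obtain ⟨s, b, hb⟩ := exists_basis_residueField_tensor m hlen'
  have hli : LinearIndependent (ResidueField R) fun i ↦ (1 : ResidueField R) ⊗ₜ[R] s i :=
    (funext hb : ⇑b = _) ▸ b.linearIndependent
  exact ⟨(LinearEquiv.ofBijective (sumTmul R A s) ⟨sumTmul_injective A hli,
    sumTmul_surjective A (span_sup_maximalIdeal_smul_top_eq_top b hb)⟩).symm⟩
end

section
/- If the Krull dimension of the ring S/mS is 0, then for every Artinian R-module A the S-module A ⊗_R S is Artinian over S. -/
open IsLocalRing TensorProduct

/-- An `x`-power-torsion module is Artinian as soon as its submodule of elements killed by `x` is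
Artinian. -/
theorem isArtinian_of_isArtinian_ker_lsmul {S N : Type*} [CommRing S] [AddCommGroup N] [Module S N]
    (x : S) (htors : ∀ b : N, ∃ k : ℕ, x ^ k • b = 0)
    [IsArtinian S (LinearMap.lsmul S N x).ker] : IsArtinian S N := by
  rw [← monotone_stabilizes_iff_artinian]
  intro f
  let F (i : ℕ) : Submodule S N := OrderDual.ofDual (f i)
  have hF {i j : ℕ} (h : i ≤ j) : F j ≤ F i := f.monotone h
  let L (i k : ℕ) : Submodule S (LinearMap.lsmul S N x).ker :=
    ((F i).map (LinearMap.lsmul S N (x ^ k))).comap (LinearMap.lsmul S N x).ker.subtype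
  have mem_L (i k : ℕ) (z : (LinearMap.lsmul S N x).ker) :
      z ∈ L i k ↔ ∃ y ∈ F i, x ^ k • y = z := by simp [L]
  have hLi {i j : ℕ} (k : ℕ) (h : i ≤ j) : L j k ≤ L i k :=
    Submodule.comap_mono (Submodule.map_mono (hF h))
  have hLk (i : ℕ) {k l : ℕ} (h : k ≤ l) : L i l ≤ L i k := by
    intro z hz
    obtain ⟨y, hy, hyz⟩ := (mem_L _ _ _).1 hz
    refine (mem_L _ _ _).2 ⟨x ^ (l - k) • y, (F i).smul_mem _ hy, ?_⟩
    rw [← mul_smul, ← pow_add, Nat.add_sub_cancel' h, hyz]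
  obtain ⟨m, hm⟩ := IsArtinian.monotone_stabilizes
    (⟨fun i ↦ OrderDual.toDual (L i i), fun i j h ↦ (hLk j h).trans (hLi i h)⟩ :
      ℕ →o (Submodule S (LinearMap.lsmul S N x).ker)ᵒᵈ)
  replace hm : ∀ i, m ≤ i → L m m = L i i := hm
  choose g hg using fun k ↦ IsArtinian.monotone_stabilizes
    (⟨fun i ↦ OrderDual.toDual (L i k), fun i j h ↦ hLi k h⟩ :
      ℕ →o (Submodule S (LinearMap.lsmul S N x).ker)ᵒᵈ)
  replace hg : ∀ k i, g k ≤ i → L (g k) k = L i k := hg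
  let n := m + (Finset.range m).sup g
  have key (j k : ℕ) (hj : n ≤ j) : L n k ≤ L j k := by
    rcases lt_or_ge k m with hk | hk
    · have hgn : g k ≤ n :=
        (Finset.le_sup (f := g) (Finset.mem_range.2 hk)).trans (Nat.le_add_left _ _)
      rw [← hg k n hgn, ← hg k j (hgn.trans hj)]
    · have hmn : m ≤ n := Nat.le_add_right _ _
      calc L n k ≤ L m m := (hLi k hmn).trans (hLk m hk)
        _ = L (max j k) (max j k) := hm _ (hk.trans (le_max_right _ _))
        _ ≤ L j k := (hLi _ (le_max_left _ _)).trans (hLk j (le_max_right _ _))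
  refine ⟨n, fun j hj ↦ ?_⟩
  suffices h : ∀ k : ℕ, ∀ b ∈ F n, x ^ k • b = 0 → b ∈ F j from
    le_antisymm (α := Submodule S N) (fun b hb ↦ (htors b).elim fun k hk ↦ h k b hb hk) (hF hj)
  intro k
  induction k with
  | zero => intro b _ hb; simp_all
  | succ k ih =>
    intro b hb hxb
    have hker : x ^ k • b ∈ (LinearMap.lsmul S N x).ker := by
      rwa [LinearMap.mem_ker, LinearMap.lsmul_apply, ← mul_smul, ← pow_succ']
    obtain ⟨c, hc, hcb⟩ := (mem_L j k _).1 (key j k hj ((mem_L n k ⟨_, hker⟩).2 ⟨b, hb, rfl⟩))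
    have := ih (b - c) (sub_mem hb (hF hj hc)) (by rw [smul_sub, hcb, sub_self])
    simpa using add_mem this hc

/-- Over a local ring, every element of an Artinian module is killed by a power of any element of
the maximal ideal. -/
theorem IsLocalRing.exists_pow_smul_eq_zero_of_isArtinian {R B : Type*} [CommRing R] [IsLocalRing R]
    [AddCommGroup B] [Module R B] [IsArtinian R B] {x : R} (hx : x ∈ maximalIdeal R) (b : B) :
    ∃ k : ℕ, x ^ k • b = 0 := by
  let b' : Submodule.span R {b} := ⟨b, Submodule.mem_span_singleton_self b⟩
  obtain ⟨n, ⟨c, hc⟩, hcb⟩ := IsArtinian.exists_pow_succ_smul_dvd x b'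
  obtain ⟨r, rfl⟩ := Submodule.mem_span_singleton.1 hc
  replace hcb : x ^ (n + 1) • r • b = x ^ n • b := congrArg Subtype.val hcb
  have hunit : IsUnit (1 - x * r) :=
    IsLocalRing.isUnit_one_sub_self_of_mem_nonunits _ ((maximalIdeal R).mul_mem_right r hx)
  refine ⟨n, (hunit.smul_eq_zero).1 ?_⟩
  rw [sub_smul, one_smul, sub_eq_zero]
  nth_rw 1 [← hcb]
  rw [smul_smul, smul_smul]
  congr 1
  ring

/-- A module over a local ring which is Artinian and killed by the maximal ideal is finite. -/
theorem IsLocalRing.finite_of_isArtinian_of_le_annihilator {R B : Type*} [CommRing R]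
    [IsLocalRing R] [AddCommGroup B] [Module R B] [IsArtinian R B]
    (h : maximalIdeal R ≤ Module.annihilator R B) : Module.Finite R B := by
  have hB : Module.IsTorsionBySet R B (maximalIdeal R) :=
    Module.isTorsionBySet_iff_subset_annihilator _ _ |>.2 h
  let _ := hB.module
  have : IsArtinian (R ⧸ maximalIdeal R) B := isArtinian_of_tower R inferInstance
  let _ := Ideal.Quotient.field (maximalIdeal R)
  have : Module.Finite (R ⧸ maximalIdeal R) B := IsSemisimpleModule.finite_tfae.out 2 0 |>.1 ‹_›
  exact .trans (R ⧸ maximalIdeal R) B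

theorem isArtinian_of_finite_of_le_annihilator {S N : Type*} [CommRing S] [AddCommGroup N]
    [Module S N] [Module.Finite S N] (I : Ideal S) [IsArtinianRing (S ⧸ I)]
    (h : I ≤ Module.annihilator S N) : IsArtinian S N := by
  have hN : Module.IsTorsionBySet S N I := Module.isTorsionBySet_iff_subset_annihilator _ _ |>.2 h
  let _ := hN.module
  have : Module.Finite (S ⧸ I) N := .of_restrictScalars_finite S (S ⧸ I) N
  exact isArtinian_of_surjective_algebraMap (R := S ⧸ I) Ideal.Quotient.mk_surjective

/-- Let `R → S` be flat with `R` local and `S/mS` Artinian. If `m` is generated by a finite set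
modulo the annihilator of an Artinian module, then the base change of this module is Artinian. -/
theorem isArtinian_baseChange_of_maximalIdeal_le {R S : Type*} [CommRing R] [CommRing S]
    [IsLocalRing R] [Algebra R S] [Module.Flat R S]
    [IsArtinianRing (S ⧸ (maximalIdeal R).map (algebraMap R S))] (t : Finset R)
    (ht : (t : Set R) ⊆ maximalIdeal R) (A : Type*) [AddCommGroup A] [Module R A] [IsArtinian R A]
    (h : maximalIdeal R ≤ Module.annihilator R A ⊔ Ideal.span t) :
    IsArtinian S (S ⊗[R] A) := by
  classical
  induction t using Finset.induction_on generalizing A with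
  | empty =>
    replace h : maximalIdeal R ≤ Module.annihilator R A := by simpa using h
    have := IsLocalRing.finite_of_isArtinian_of_le_annihilator h
    refine isArtinian_of_finite_of_le_annihilator ((maximalIdeal R).map (algebraMap R S)) ?_
    rw [Ideal.map_le_iff_le_comap]
    intro x hx
    rw [Ideal.mem_comap, Module.mem_annihilator]
    intro z
    induction z with
    | zero => simp
    | add y z hy hz => rw [smul_add, hy, hz, add_zero]
    | tmul s a =>
      rw [algebraMap_smul, ← TensorProduct.tmul_smul, Module.mem_annihilator.1 (h hx),
        TensorProduct.tmul_zero]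
  | insert x t _ ih =>
    rw [Finset.coe_insert, Set.insert_subset_iff] at ht
    let K := (LinearMap.lsmul R A x).ker
    have hK : IsArtinian S (S ⊗[R] K) := by
      refine ih ht.2 K (h.trans ?_)
      rw [Finset.coe_insert, Ideal.span_insert, ← sup_assoc]
      refine sup_le_sup_right (sup_le ?_ ?_) _
      · exact K.subtype.annihilator_le_of_injective K.subtype_injective
      · rw [Ideal.span_singleton_le_iff_mem, Module.mem_annihilator]
        exact fun a ↦ Subtype.ext a.2
    have hexact : Function.Exact (K.subtype.baseChange S) ((LinearMap.lsmul R A x).baseChange S) :=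
      Module.Flat.lTensor_exact S (LinearMap.exact_subtype_ker_map _)
    have hlsmul : (LinearMap.lsmul R A x).baseChange S =
        LinearMap.lsmul S (S ⊗[R] A) (algebraMap R S x) := by
      ext a
      simp
    rw [hlsmul, LinearMap.exact_iff] at hexact
    have : IsArtinian S (LinearMap.lsmul S (S ⊗[R] A) (algebraMap R S x)).ker := by
      rw [hexact]
      exact isArtinian_of_surjective _ _ (K.subtype.baseChange S).surjective_rangeRestrict
    refine isArtinian_of_isArtinian_ker_lsmul (algebraMap R S x) fun z ↦ ?_
    induction z with
    | zero => exact ⟨0, by simp⟩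
    | add y z hy hz =>
      obtain ⟨k, hk⟩ := hy
      obtain ⟨l, hl⟩ := hz
      refine ⟨k + l, ?_⟩
      rw [smul_add, pow_add, mul_smul _ _ z, hl, mul_comm, mul_smul, hk, smul_zero, smul_zero,
        add_zero]
    | tmul s a =>
      obtain ⟨k, hk⟩ := IsLocalRing.exists_pow_smul_eq_zero_of_isArtinian ht.1 a
      exact ⟨k, by rw [← map_pow, algebraMap_smul, ← TensorProduct.tmul_smul, hk,
        TensorProduct.tmul_zero]⟩

/-- If `dim (S/mS) = 0`, then for every Artinian `R`-module `A` the base change of `A` to `S`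
(the tensor product of `A` and `S` over `R`, with the `S`-action on the `S` factor)
is an Artinian `S`-module. -/
theorem stmt4 (R S : Type*) [CommRing R] [CommRing S] [IsNoetherianRing R] [IsNoetherianRing S]
    [IsLocalRing R] [IsLocalRing S] [Algebra R S] [Module.Flat R S]
    [IsLocalHom (algebraMap R S)]
    (hdim : ringKrullDim (S ⧸ (maximalIdeal R).map (algebraMap R S)) = 0)
    (A : Type*) [AddCommGroup A] [Module R A] [IsArtinian R A] :
    IsArtinian S (S ⊗[R] A) := by
  have : Ring.KrullDimLE 0 (S ⧸ (maximalIdeal R).map (algebraMap R S)) :=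
    Ring.krullDimLE_iff.2 hdim.le
  have := IsNoetherianRing.isArtinianRing_of_krullDimLE_zero
    (R := S ⧸ (maximalIdeal R).map (algebraMap R S))
  obtain ⟨t, ht⟩ := (maximalIdeal R).fg_of_isNoetherianRing
  exact isArtinian_baseChange_of_maximalIdeal_le t (ht ▸ Ideal.subset_span) A
    (ht.ge.trans le_sup_right)
end

section
/- If there exists a nonzero Artinian R-module A such that the S-module A ⊗_R S is Artinian over S, then the Krull dimension of the ring S/mS is 0. -/
open IsLocalRing TensorProduct

theorem IsLocalRing.exists_injective_quotient_maximalIdeal_of_isArtinian (R A : Type*) [CommRing R]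
    [IsLocalRing R] [AddCommGroup A] [Module R A] [Nontrivial A] [IsArtinian R A] :
    ∃ f : (R ⧸ maximalIdeal R) →ₗ[R] A, Function.Injective f := by
  obtain ⟨N, hN, -⟩ := (eq_bot_or_exists_atom_le (⊤ : Submodule R A)).resolve_left top_ne_bot
  have : IsSimpleModule R N := isSimpleModule_iff_isAtom.mpr hN
  obtain ⟨I, hI, ⟨e⟩⟩ := isSimpleModule_iff_quot_maximal.mp this
  obtain rfl := IsLocalRing.eq_maximalIdeal hI
  exact ⟨N.subtype ∘ₗ e.symm.toLinearMap, N.injective_subtype.comp e.symm.injective⟩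

/-- If there is a nonzero Artinian `R`-module `A` whose base change to `S` is an Artinian
`S`-module, then `dim (S/mS) = 0`. -/
theorem stmt5 (R S : Type*) [CommRing R] [CommRing S] [IsNoetherianRing R] [IsNoetherianRing S]
    [IsLocalRing R] [IsLocalRing S] [Algebra R S] [Module.Flat R S]
    [IsLocalHom (algebraMap R S)]
    (A : Type*) [AddCommGroup A] [Module R A] [Nontrivial A] [IsArtinian R A]
    (hart : IsArtinian S (S ⊗[R] A)) :
    ringKrullDim (S ⧸ (maximalIdeal R).map (algebraMap R S)) = 0 := by
  obtain ⟨f, hf⟩ := exists_injective_quotient_maximalIdeal_of_isArtinian R A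
  have : IsArtinian S (S ⊗[R] (R ⧸ maximalIdeal R)) :=
    isArtinian_of_injective (f.baseChange S) (Module.Flat.lTensor_preserves_injective_linearMap f hf)
  have : IsArtinian S (S ⧸ (maximalIdeal R).map (algebraMap R S)) :=
    isArtinian_of_linearEquiv
      (Algebra.TensorProduct.quotIdealMapEquivTensorQuot S (maximalIdeal R)).symm.toLinearEquiv
  have : IsArtinianRing (S ⧸ (maximalIdeal R).map (algebraMap R S)) := isArtinian_of_tower S this
  have : Nontrivial (S ⧸ (maximalIdeal R).map (algebraMap R S)) :=
    Ideal.Quotient.nontrivial_iff.mpr (ne_top_of_le_ne_top (maximalIdeal.isMaximal S).ne_top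
      (((local_hom_TFAE (algebraMap R S)).out 0 2).mp ‹_›))
  exact ringKrullDimZero_iff_ringKrullDim_eq_zero.mp inferInstance
end

section
/- If the Krull dimension of the ring S/mS is 0, then for every R-module A of finite length over R, the S-module A ⊗_R S has finite length over S, and ℓ_S(A ⊗_R S) = ℓ_R(A) · ℓ_S(S/mS). -/
open IsLocalRing TensorProduct CategoryTheory

/-- If `dim (S/mS) = 0`, then for every `R`-module `A` of finite length, the base change of
`A` to `S` has finite length over `S` and `ℓ_S(A ⊗_R S) = ℓ_R(A) * ℓ_S(S/mS)`. -/
theorem stmt6 (R S : Type*) [CommRing R] [CommRing S] [IsNoetherianRing R] [IsNoetherianRing S]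
    [IsLocalRing R] [IsLocalRing S] [Algebra R S] [Module.Flat R S]
    [IsLocalHom (algebraMap R S)]
    (hdim : ringKrullDim (S ⧸ (maximalIdeal R).map (algebraMap R S)) = 0)
    (A : Type*) [AddCommGroup A] [Module R A] (hA : IsFiniteLength R A) :
    IsFiniteLength S (S ⊗[R] A) ∧
      moduleLength S (S ⊗[R] A) =
        moduleLength R A * moduleLength S (S ⧸ (maximalIdeal R).map (algebraMap R S)) := by
  set Q := S ⧸ (maximalIdeal R).map (algebraMap R S)
  have : Ring.KrullDimLE 0 Q := Ring.krullDimLE_iff.mpr hdim.le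
  have : IsArtinianRing Q := IsNoetherianRing.isArtinianRing_of_krullDimLE_zero
  have hQ : Module.length S Q ≠ ⊤ := by
    rw [Module.length_eq_of_surjective (M := Q) (S := S) (R := Q) Ideal.Quotient.mk_surjective]
    exact Module.length_ne_top
  have hlen := IsLocalRing.length_baseChange (A := R) (B := S) (M := A)
  refine ⟨Module.length_ne_top_iff.mp ?_, ?_⟩
  · rw [hlen]
    exact WithTop.mul_ne_top (Module.length_ne_top_iff.mpr hA) hQ
  · simp only [moduleLength, ← Module.coe_length]
    rw [hlen, WithBot.coe_mul]
end

section
/- If there exists a nonzero S-module B of finite length over S such that B is Artinian as an R-module by restriction of scalars along φ, then the R-module S/n has finite length. -/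
open IsLocalRing TensorProduct

/-- For a local homomorphism `R → S` with `R` Noetherian, if the residue field of `S` is an Artinian `R`-module,
then it has finite length over `R`. -/
theorem isFiniteLength_residueField_of_isArtinian (R S : Type*) [CommRing R] [CommRing S]
    [IsNoetherianRing R] [IsLocalRing R] [IsLocalRing S] [Algebra R S] [IsLocalHom (algebraMap R S)]
    [hart : IsArtinian R (ResidueField S)] : IsFiniteLength R (ResidueField S) := by
  have : IsArtinian (ResidueField R) (ResidueField S) := isArtinian_of_tower R hart
  have : Module.Finite (ResidueField R) (ResidueField S) :=
    (IsSemisimpleModule.finite_tfae.out 0 2).mpr this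
  have : Module.Finite R (ResidueField S) := .trans (ResidueField R) (ResidueField S)
  have : IsNoetherian R (ResidueField S) := isNoetherian_of_isNoetherianRing_of_finite R _
  exact isFiniteLength_iff_isNoetherian_isArtinian.mpr ⟨this, hart⟩

/-- A nonzero finite length module over a local ring receives an embedding from the
residue field. -/
theorem IsFiniteLength.exists_injective_of_isLocalRing {S B : Type*} [CommRing S] [IsLocalRing S]
    [AddCommGroup B] [Module S B] [Nontrivial B] (hB : IsFiniteLength S B) :
    ∃ f : (S ⧸ maximalIdeal S) →ₗ[S] B, Function.Injective f := by
  have := (isFiniteLength_iff_isNoetherian_isArtinian.mp hB).2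
  obtain ⟨N, hN⟩ := IsAtomic.exists_atom (Submodule S B)
  have := isSimpleModule_iff_isAtom.mpr hN
  obtain ⟨I, hI, ⟨e⟩⟩ := isSimpleModule_iff_quot_maximal.mp this
  obtain rfl := eq_maximalIdeal hI
  exact ⟨N.subtype ∘ₗ e.symm.toLinearMap, N.injective_subtype.comp e.symm.injective⟩

/-- If there is a nonzero finite length `S`-module `B` which is Artinian as an `R`-module
by restriction of scalars along the flat local map `R → S`, then the `R`-module `S/n`
has finite length. -/
theorem stmt9 (R S : Type*) [CommRing R] [CommRing S] [IsNoetherianRing R] [IsNoetherianRing S]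
    [IsLocalRing R] [IsLocalRing S] [Algebra R S] [Module.Flat R S]
    [IsLocalHom (algebraMap R S)]
    (B : Type*) [AddCommGroup B] [Module S B] [Nontrivial B] (hB : IsFiniteLength S B)
    (hart : IsArtinian R (RestrictScalars R S B)) :
    IsFiniteLength R (S ⧸ maximalIdeal S) := by
  let : Module R B := Module.compHom B (algebraMap R S)
  have : IsScalarTower R S B := IsScalarTower.of_algebraMap_smul fun _ _ ↦ rfl
  have hart' : IsArtinian R B := hart
  obtain ⟨f, hf⟩ := hB.exists_injective_of_isLocalRing
  have : IsArtinian R (ResidueField S) :=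
    isArtinian_of_injective (f.restrictScalars R) hf
  exact isFiniteLength_residueField_of_isArtinian R S
end

section
/- Suppose the R-module S/mS has length 1 (equivalently, the induced map R/m → S/mS is an isomorphism). Then for every Artinian R-module A, the natural R-linear map A → A ⊗_R S sending a to a ⊗ 1 is bijective. -/
open IsLocalRing TensorProduct CategoryTheory

/-- Every element of an Artinian module over a Noetherian local ring is killed by a power of the
maximal ideal. -/
theorem exists_pow_maximalIdeal_smul_eq_zero {R A : Type*} [CommRing R] [IsNoetherianRing R]
    [IsLocalRing R] [AddCommGroup A] [Module R A] [IsArtinian R A] (a : A) :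
    ∃ n : ℕ, ∀ r ∈ maximalIdeal R ^ n, r • a = 0 := by
  obtain ⟨n, hn⟩ := IsArtinian.monotone_stabilizes (R := R) (M := A)
    ⟨fun n => OrderDual.toDual (maximalIdeal R ^ n • Submodule.span R {a}),
      fun i j hij => Submodule.smul_mono_left (Ideal.pow_le_pow_right hij)⟩
  have h : maximalIdeal R ^ n • Submodule.span R {a} =
      maximalIdeal R ^ (n + 1) • Submodule.span R {a} := hn (n + 1) n.le_succ
  have hbot : maximalIdeal R ^ n • Submodule.span R {a} = ⊥ := by
    refine Submodule.eq_bot_of_le_smul_of_le_jacobson_bot (maximalIdeal R) _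
      (Submodule.FG.smul (IsNoetherian.noetherian _) (Submodule.fg_span_singleton a)) ?_
      (maximalIdeal_le_jacobson _)
    rw [← mul_smul, ← pow_succ', ← h]
  refine ⟨n, fun r hr => ?_⟩
  rw [← Submodule.mem_bot R, ← hbot]
  exact Submodule.smul_mem_smul hr (Submodule.mem_span_singleton_self a)

theorem Submodule.sup_pow_smul_top_eq_top {R M : Type*} [CommRing R] [AddCommGroup M] [Module R M]
    {I : Ideal R} {N : Submodule R M} (h : N ⊔ I • ⊤ = ⊤) (n : ℕ) : N ⊔ I ^ n • ⊤ = ⊤ := by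
  induction n with
  | zero => simp
  | succ n ih =>
    refine top_le_iff.1 (ih.symm.le.trans ?_)
    refine sup_le le_sup_left ?_
    calc I ^ n • (⊤ : Submodule R M) = I ^ n • (N ⊔ I • ⊤) := by rw [h]
      _ = I ^ n • N ⊔ I ^ (n + 1) • ⊤ := by rw [Submodule.smul_sup, pow_succ, mul_smul]
      _ ≤ N ⊔ I ^ (n + 1) • ⊤ := sup_le_sup_right Submodule.smul_le_right _

theorem TensorProduct.tmul_eq_zero_of_mem_smul_top {R M N : Type*} [CommRing R] [AddCommGroup M]
    [Module R M] [AddCommGroup N] [Module R N] {I : Ideal R} {x : M} (hx : ∀ r ∈ I, r • x = 0)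
    {y : N} (hy : y ∈ I • (⊤ : Submodule R N)) : x ⊗ₜ[R] y = 0 := by
  induction hy using Submodule.smul_induction_on' with
  | smul r hr z _ => rw [← TensorProduct.smul_tmul, hx r hr, TensorProduct.zero_tmul]
  | add y _ z _ hy hz => rw [TensorProduct.tmul_add, hy, hz, add_zero]

/-- If `S / IS` is a simple `R`-module, then `S = R · 1 + IS`. -/
theorem Ideal.span_one_sup_smul_top_eq_top {R S : Type*} [CommRing R] [CommRing S] [Algebra R S]
    (I : Ideal R) [IsSimpleModule R (S ⧸ I.map (algebraMap R S))] :
    Submodule.span R {(1 : S)} ⊔ I • ⊤ = ⊤ := by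
  have : Nontrivial (S ⧸ I.map (algebraMap R S)) := IsSimpleModule.nontrivial R _
  refine eq_top_iff.2 fun s _ => ?_
  obtain ⟨r, hr⟩ := IsSimpleModule.toSpanSingleton_surjective R
    (one_ne_zero (α := S ⧸ I.map (algebraMap R S))) (Ideal.Quotient.mk _ s)
  have hmem : s - r • (1 : S) ∈ I • (⊤ : Submodule R S) := by
    rw [Ideal.smul_top_eq_map, Submodule.restrictScalars_mem, ← Ideal.Quotient.eq, ← hr]
    simp [Algebra.smul_def]
  rw [← add_sub_cancel (r • (1 : S)) s]
  exact Submodule.add_mem_sup (Submodule.smul_mem _ r (Submodule.mem_span_singleton_self 1)) hmem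

/-- If the `R`-module `S/mS` has length `1`, then for every Artinian `R`-module `A` the
natural map `A → A ⊗_R S`, `a ↦ a ⊗ 1`, is bijective. -/
theorem stmt10 (R S : Type*) [CommRing R] [CommRing S] [IsNoetherianRing R] [IsNoetherianRing S]
    [IsLocalRing R] [IsLocalRing S] [Algebra R S] [Module.Flat R S]
    [IsLocalHom (algebraMap R S)]
    (hlen : moduleLength R (S ⧸ (maximalIdeal R).map (algebraMap R S)) = 1)
    (A : Type*) [AddCommGroup A] [Module R A] [IsArtinian R A] :
    Function.Bijective (fun a : A => a ⊗ₜ[R] (1 : S)) := by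
  have : Module.FaithfullyFlat R S := Module.FaithfullyFlat.of_flat_of_isLocalHom
  have : IsSimpleModule R (S ⧸ (maximalIdeal R).map (algebraMap R S)) := by
    rw [← Module.length_eq_one_iff]
    rw [moduleLength, ← Module.coe_length] at hlen
    exact_mod_cast hlen
  refine ⟨(TensorProduct.comm R S A).injective.comp
    (Module.FaithfullyFlat.tensorProduct_mk_injective (A := R) (B := S) A), fun x => ?_⟩
  induction x using TensorProduct.induction_on with
  | zero => exact ⟨0, TensorProduct.zero_tmul _ _⟩
  | add x y hx hy =>
    obtain ⟨a, rfl⟩ := hx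
    obtain ⟨b, rfl⟩ := hy
    exact ⟨a + b, TensorProduct.add_tmul _ _ _⟩
  | tmul a s =>
    obtain ⟨n, hn⟩ := exists_pow_maximalIdeal_smul_eq_zero (R := R) a
    have hs : s ∈ Submodule.span R {(1 : S)} ⊔ maximalIdeal R ^ n • ⊤ := by
      rw [Submodule.sup_pow_smul_top_eq_top (maximalIdeal R).span_one_sup_smul_top_eq_top]
      trivial
    obtain ⟨u, hu, t, ht, rfl⟩ := Submodule.mem_sup.1 hs
    obtain ⟨r, rfl⟩ := Submodule.mem_span_singleton.1 hu
    refine ⟨r • a, ?_⟩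
    simp only [TensorProduct.tmul_add, TensorProduct.tmul_eq_zero_of_mem_smul_top hn ht, add_zero,
      TensorProduct.smul_tmul]
end

section
/- Suppose the R-module S/mS has length 1. Then for every Artinian R-module A and every integer i > 0, the Ext group Ext^i_R(S, A) vanishes (is the zero module), where S is regarded as an R-module by restriction of scalars along φ. -/
open IsLocalRing TensorProduct CategoryTheory

universe u

/-- A family of partial conditions `h x = a`, `(x, a) ∈ G`, on a linear map `h` into an Artinian
module is solvable as soon as every finite subfamily is. -/
theorem IsArtinian.exists_linearMap_of_finite {R P A : Type*} [CommRing R] [AddCommGroup P]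
    [Module R P] [AddCommGroup A] [Module R A] [IsArtinian R A] (G : Set (P × A))
    (hG : ∀ T ⊆ G, T.Finite → ∃ h : P →ₗ[R] A, ∀ p ∈ T, h p.1 = p.2) :
    ∃ h : P →ₗ[R] A, ∀ p ∈ G, h p.1 = p.2 := by
  let F : Set (Set (P × A)) :=
    {G | ∀ T ⊆ G, T.Finite → ∃ h : P →ₗ[R] A, ∀ p ∈ T, h p.1 = p.2}
  have hF : Order.IsOfFiniteCharacter F := fun X =>
    ⟨fun hX Y hY _ T hT hTf => hX T (hT.trans hY) hTf,
      fun hX T hT hTf => hX T hT hTf T subset_rfl hTf⟩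
  obtain ⟨M, hGM, hM⟩ := hF.exists_maximal (x := G) hG
  have hMF : ∀ T ⊆ M, T.Finite → ∃ h : P →ₗ[R] A, ∀ p ∈ T, h p.1 = p.2 := hM.prop
  have total : ∀ x, ∃ a, (x, a) ∈ M := by
    intro x
    let D : Set (P × A) → Submodule R A := fun T =>
      { carrier := {a | ∃ h : P →ₗ[R] A, (∀ p ∈ T, h p.1 = 0) ∧ h x = a}
        add_mem' := by
          rintro _ _ ⟨h, h0, rfl⟩ ⟨k, k0, rfl⟩
          exact ⟨h + k, fun p hp => by simp [h0 p hp, k0 p hp], rfl⟩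
        zero_mem' := ⟨0, by simp, rfl⟩
        smul_mem' := by
          rintro r _ ⟨h, h0, rfl⟩
          exact ⟨r • h, fun p hp => by simp [h0 p hp], rfl⟩ }
    obtain ⟨_, ⟨T₀, ⟨hT₀, hT₀f⟩, rfl⟩, hmin⟩ := IsArtinian.set_has_minimal
      (D '' {T | T ⊆ M ∧ T.Finite}) ⟨_, ∅, ⟨Set.empty_subset _, Set.finite_empty⟩, rfl⟩
    obtain ⟨h₀, hh₀⟩ := hMF T₀ hT₀ hT₀f
    have key : ∀ T ⊆ M, T.Finite → ∃ h : P →ₗ[R] A, (∀ p ∈ T, h p.1 = p.2) ∧ h x = h₀ x := by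
      intro T hT hTf
      obtain ⟨h, hh⟩ := hMF (T₀ ∪ T) (Set.union_subset hT₀ hT) (hT₀f.union hTf)
      have hle : D (T₀ ∪ T) ≤ D T₀ := by
        rintro _ ⟨k, hk, rfl⟩
        exact ⟨k, fun p hp => hk p (Or.inl hp), rfl⟩
      have heq : D (T₀ ∪ T) = D T₀ := by
        by_contra hne
        exact hmin _ ⟨_, ⟨Set.union_subset hT₀ hT, hT₀f.union hTf⟩, rfl⟩ (lt_of_le_of_ne hle hne)
      have hmem : h₀ x - h x ∈ D T₀ :=
        ⟨h₀ - h, fun p hp => by simp [hh₀ p hp, hh p (Or.inl hp)], rfl⟩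
      rw [← heq] at hmem
      obtain ⟨k, hk, hkx⟩ := hmem
      exact ⟨h + k, fun p hp => by simp [hh p (Or.inr hp), hk p (Or.inr hp)], by simp [hkx]⟩
    refine ⟨h₀ x, ?_⟩
    have hins : insert (x, h₀ x) M ∈ F := by
      intro T hT hTf
      obtain ⟨h, hh, hx⟩ := key (T \ {(x, h₀ x)}) (by simpa using hT) (hTf.sdiff)
      refine ⟨h, fun p hp => ?_⟩
      by_cases hpx : p = (x, h₀ x)
      · rw [hpx]; exact hx
      · exact hh p ⟨hp, hpx⟩
    exact hM.le_of_ge hins (Set.subset_insert _ _) (Set.mem_insert _ _)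
  choose φ hφ using total
  have local_eq : ∀ s : Set P, s.Finite → ∃ h : P →ₗ[R] A, ∀ x ∈ s, h x = φ x := by
    intro s hs
    obtain ⟨h, hh⟩ := hMF ((fun x => (x, φ x)) '' s)
      (by rintro _ ⟨x, _, rfl⟩; exact hφ x) (hs.image _)
    exact ⟨h, fun x hx => hh _ ⟨x, hx, rfl⟩⟩
  refine ⟨{ toFun := φ, map_add' := fun x y => ?_, map_smul' := fun r x => ?_ }, ?_⟩
  · obtain ⟨h, hh⟩ := local_eq {x, y, x + y} (by simp)
    rw [← hh (x + y) (by simp), ← hh x (by simp), ← hh y (by simp), map_add]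
  · obtain ⟨h, hh⟩ := local_eq {x, r • x} (by simp)
    rw [← hh (r • x) (by simp), ← hh x (by simp), map_smul, RingHom.id_apply]
  · rintro ⟨x, a⟩ hxa
    obtain ⟨h, hh⟩ := hMF {(x, a), (x, φ x)}
      (by rintro _ (rfl | rfl); exacts [hGM hxa, hφ x]) (by simp)
    exact (hh (x, φ x) (by simp)).symm.trans (hh (x, a) (by simp))

/-- The kernel of a surjection between flat modules is flat. -/
theorem Module.Flat.ker_of_surjective {R P M : Type*} [CommRing R] [AddCommGroup P]
    [Module R P] [AddCommGroup M] [Module R M] [Module.Flat R P] [Module.Flat R M]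
    (π : P →ₗ[R] M) (hπ : Function.Surjective π) : Module.Flat R (LinearMap.ker π) := by
  refine Module.Flat.of_forall_exists_factorization fun {l f x} hx => ?_
  obtain ⟨k, a, y, hya, haf⟩ := Module.Flat.exists_factorization_of_apply_eq_zero_of_free
    (f := f) (x := (LinearMap.ker π).subtype ∘ₗ x) (by simp [hx])
  have h0 : (π ∘ₗ y) ∘ₗ a = 0 := by
    rw [LinearMap.comp_assoc, ← hya]
    ext; simp
  obtain ⟨j, b, z, hzb, hba⟩ := Module.Flat.exists_factorization_of_comp_eq_zero_of_free h0
  obtain ⟨w, hw⟩ := Module.projective_lifting_property π z hπ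
  refine ⟨k, a, (y - w ∘ₗ b).codRestrict _ fun v => ?_, ?_, haf⟩
  · have h1 := LinearMap.congr_fun hzb v
    have h2 := LinearMap.congr_fun hw (b v)
    simp only [LinearMap.comp_apply] at h1 h2
    simp [h1, h2]
  · refine LinearMap.ext fun v => Subtype.ext ?_
    have h1 := LinearMap.congr_fun hya v
    have h2 := LinearMap.congr_fun hba v
    simp only [LinearMap.comp_apply, Submodule.subtype_apply, LinearMap.zero_apply] at h1 h2
    simp [h1, h2]

/-- A surjection of a projective module onto a flat module is locally split: any finitely generated
submodule of the kernel is fixed by some map into the kernel. -/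
theorem Module.Flat.exists_linearMap_ker_fixing {R P M : Type*} [CommRing R] [AddCommGroup P]
    [Module R P] [AddCommGroup M] [Module R M] [Module.Projective R P] [Module.Flat R M]
    (π : P →ₗ[R] M) (hπ : Function.Surjective π) (T : Set P) (hT : T.Finite)
    (hTπ : T ⊆ LinearMap.ker π) :
    ∃ θ : P →ₗ[R] LinearMap.ker π, ∀ t ∈ T, (θ t : P) = t := by
  classical
  obtain ⟨s, hs⟩ := Module.projective_def'.mp ‹Module.Projective R P›
  let X : Finset P := hT.toFinset.biUnion fun t => (s t).support
  let u : P →ₗ[R] Finsupp.supported R R (X : Set P) := Finsupp.restrictDom R R (X : Set P) ∘ₗ s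
  let v : Finsupp.supported R R (X : Set P) →ₗ[R] P :=
    Finsupp.linearCombination R id ∘ₗ Submodule.subtype _
  have huv : ∀ t ∈ T, v (u t) = t := by
    intro t ht
    have hres : ((u t : Finsupp.supported R R (X : Set P)) : P →₀ R) = s t := by
      refine (Finsupp.filter_eq_self_iff _ _).2 fun x hx => ?_
      simp only [X, Finset.coe_biUnion, Set.mem_iUnion]
      exact ⟨t, by simpa using ht, by simpa using hx⟩
    have := LinearMap.congr_fun hs t
    simpa [v, hres] using this
  have : Module.Finite R (Finsupp.supported R R (X : Set P)) :=
    Module.Finite.equiv (Finsupp.supportedEquivFinsupp (X : Set P)).symm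
  have : Module.Free R (Finsupp.supported R R (X : Set P)) :=
    Module.Free.of_equiv (Finsupp.supportedEquivFinsupp (X : Set P)).symm
  have : Module.Finite R (Submodule.span R T) := Module.Finite.span_of_finite R hT
  have h0 : (π ∘ₗ v) ∘ₗ (u ∘ₗ (Submodule.span R T).subtype) = 0 := by
    have hle : Submodule.span R T ≤ LinearMap.ker (π ∘ₗ v ∘ₗ u) := by
      refine Submodule.span_le.2 fun t ht => ?_
      have := hTπ ht
      simp only [SetLike.mem_coe, LinearMap.mem_ker] at this
      simp [huv t ht, this]
    ext ⟨t, ht⟩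
    exact hle ht
  obtain ⟨j, b, z, hzb, hbu⟩ := Module.Flat.exists_factorization_of_comp_eq_zero_of_free (R := R) (M := M)
    (K := Submodule.span R T) (N := Finsupp.supported R R (X : Set P)) h0
  obtain ⟨w, hw⟩ := Module.projective_lifting_property π z hπ
  refine ⟨((v - w ∘ₗ b).codRestrict _ fun x => ?_) ∘ₗ u, fun t ht => ?_⟩
  · have h1 := LinearMap.congr_fun hzb x
    have h2 := LinearMap.congr_fun hw (b x)
    simp only [LinearMap.comp_apply] at h1 h2
    simp [h1, h2]
  · have h2 := LinearMap.congr_fun hbu ⟨t, Submodule.subset_span ht⟩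
    simp only [LinearMap.comp_apply, Submodule.subtype_apply, LinearMap.zero_apply] at h2
    simp [h2, huv t ht]

/-- If `P` is projective and `P ⧸ range d` is flat, then every map to an Artinian module that
vanishes on `ker d` factors through `d`. -/
theorem IsArtinian.exists_comp_eq_of_flat {R Q P A : Type*} [CommRing R] [AddCommGroup Q]
    [Module R Q] [AddCommGroup P] [Module R P] [AddCommGroup A] [Module R A] [IsArtinian R A]
    [Module.Projective R P] (d : Q →ₗ[R] P) [Module.Flat R (P ⧸ LinearMap.range d)]
    (g : Q →ₗ[R] A) (hg : LinearMap.ker d ≤ LinearMap.ker g) :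
    ∃ h : P →ₗ[R] A, h ∘ₗ d = g := by
  obtain ⟨e, he⟩ : ∃ e : LinearMap.range d →ₗ[R] A, ∀ q, e (d.rangeRestrict q) = g q :=
    ⟨(LinearMap.ker d).liftQ g hg ∘ₗ d.quotKerEquivRange.symm.toLinearMap, fun q => by
      have : d.quotKerEquivRange.symm (d.rangeRestrict q) = (LinearMap.ker d).mkQ q := by
        rw [LinearEquiv.symm_apply_eq]; rfl
      simp [this]⟩
  obtain ⟨h, hh⟩ := IsArtinian.exists_linearMap_of_finite (R := R)
    (Set.range fun q => (d q, g q)) (fun T hT hTf => by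
      obtain ⟨θ, hθ⟩ := Module.Flat.exists_linearMap_ker_fixing (LinearMap.range d).mkQ
        (Submodule.mkQ_surjective _) (Prod.fst '' T) (hTf.image _) (by
          rintro _ ⟨p, hp, rfl⟩
          obtain ⟨q, rfl⟩ := hT hp
          simp)
      have hle : LinearMap.ker (LinearMap.range d).mkQ ≤ LinearMap.range d := by simp
      refine ⟨e ∘ₗ Submodule.inclusion hle ∘ₗ θ, fun p hp => ?_⟩
      have h1 := hθ p.1 ⟨p, hp, rfl⟩
      obtain ⟨q, rfl⟩ := hT hp
      refine Eq.trans ?_ (he q)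
      exact congrArg e (Subtype.ext h1))
  exact ⟨h, LinearMap.ext fun q => hh _ ⟨q, rfl⟩⟩

/-- The cokernels in a projective resolution of a flat module are flat. -/
theorem CategoryTheory.ProjectiveResolution.flat_quotient_range {R : Type u} [CommRing R]
    {M : ModuleCat.{u} R} [Module.Flat R M] (P : ProjectiveResolution M) (n : ℕ) :
    Module.Flat R (P.complex.X n ⧸ LinearMap.range (P.complex.d (n + 1) n).hom) := by
  have hproj : ∀ k, Module.Projective R (P.complex.X k) := fun k =>
    (IsProjective.iff_projective _).2 (P.projective k)
  induction n with
  | zero =>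
    have hex := (ShortComplex.moduleCat_exact_iff_range_eq_ker _).1 P.exact₀
    have hsurj : Function.Surjective (P.π.f 0).hom :=
      (ModuleCat.epi_iff_surjective _).1 inferInstance
    have : Module.Flat R (((ChainComplex.single₀ (ModuleCat R)).obj M).X 0) := ‹Module.Flat R M›
    exact Module.Flat.of_linearEquiv ((Submodule.quotEquivOfEq _ _ hex).trans
      ((P.π.f 0).hom.quotKerEquivOfSurjective hsurj))
  | succ n ih =>
    have hex := (ShortComplex.moduleCat_exact_iff_range_eq_ker _).1 (P.exact_succ n)
    have := Module.Flat.ker_of_surjective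
      (LinearMap.range (P.complex.d (n + 1) n).hom).mkQ (Submodule.mkQ_surjective _)
    rw [Submodule.ker_mkQ] at this
    exact Module.Flat.of_linearEquiv ((Submodule.quotEquivOfEq _ _ hex).trans
      (P.complex.d (n + 1) n).hom.quotKerEquivRange)

/-- Higher `Ext` groups from a flat module to an Artinian module vanish. -/
theorem isZero_Ext_succ_of_flat_of_isArtinian {R : Type u} [CommRing R] (M A : ModuleCat.{u} R)
    [Module.Flat R M] [IsArtinian R A] (n : ℕ) :
    Limits.IsZero (((Ext R (ModuleCat R) (n + 1)).obj (Opposite.op M)).obj A) := by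
  let P := projectiveResolution M
  refine Limits.IsZero.of_iso ?_ (P.isoExt (n + 1) A)
  rw [← HomologicalComplex.exactAt_iff_isZero_homology,
    HomologicalComplex.exactAt_iff' _ n (n + 1) (n + 2) (by simp) (by simp),
    ShortComplex.moduleCat_exact_iff]
  intro (g : P.complex.X (n + 1) ⟶ A) (hg : P.complex.d (n + 2) (n + 1) ≫ g = 0)
  have : Module.Projective R (P.complex.X n) :=
    (IsProjective.iff_projective _).2 (P.projective n)
  have := P.flat_quotient_range n
  have hex := (ShortComplex.moduleCat_exact_iff_range_eq_ker _).1 (P.exact_succ n)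
  obtain ⟨h, hh⟩ := IsArtinian.exists_comp_eq_of_flat (P.complex.d (n + 1) n).hom g.hom (by
    refine hex.symm.le.trans ?_
    rintro _ ⟨x, rfl⟩
    exact LinearMap.congr_fun (congrArg ModuleCat.Hom.hom hg) x)
  exact ⟨ModuleCat.ofHom h, ModuleCat.hom_ext hh⟩

/-- If the `R`-module `S/mS` has length `1`, then for every Artinian `R`-module `A` and every
`i > 0` the group `Ext^i_R(S, A)` vanishes, where `S` is an `R`-module via the flat local
map `R → S`. -/
theorem stmt12 (R S : Type u) [CommRing R] [CommRing S] [IsNoetherianRing R] [IsNoetherianRing S]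
    [IsLocalRing R] [IsLocalRing S] [Algebra R S] [Module.Flat R S]
    [IsLocalHom (algebraMap R S)]
    (hlen : moduleLength R (S ⧸ (maximalIdeal R).map (algebraMap R S)) = 1)
    (A : Type u) [AddCommGroup A] [Module R A] [IsArtinian R A] (i : ℕ) (hi : 0 < i) :
    Subsingleton
      (((Ext R (ModuleCat R) i).obj (Opposite.op (ModuleCat.of R S))).obj (ModuleCat.of R A)) := by
  obtain ⟨n, rfl⟩ := Nat.exists_eq_succ_of_ne_zero hi.ne'
  have : Module.Flat R (ModuleCat.of R S) := inferInstanceAs (Module.Flat R S)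
  have : IsArtinian R (ModuleCat.of R A) := inferInstanceAs (IsArtinian R A)
  exact ModuleCat.subsingleton_of_isZero
    (isZero_Ext_succ_of_flat_of_isArtinian (ModuleCat.of R S) (ModuleCat.of R A) n)
end

section
/- Suppose the R-module S/mS has length 1. Then mS = n, and for every positive integer t the natural ring homomorphism R/m^t → S/m^t S induced by φ is bijective. -/
/-- If `S = R + IS`, then `S = R + I^t S` for every `t`. -/
theorem exists_sub_algebraMap_mem_map_pow {R S : Type*} [CommRing R] [CommRing S] [Algebra R S]
    {I : Ideal R} (h : ∀ s : S, ∃ r : R, s - algebraMap R S r ∈ I.map (algebraMap R S))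
    (t : ℕ) (s : S) : ∃ r : R, s - algebraMap R S r ∈ (I ^ t).map (algebraMap R S) := by
  induction t generalizing s with
  | zero => exact ⟨0, by simp [Ideal.map_top]⟩
  | succ t ih =>
    have key : ∀ x ∈ (I ^ t).map (algebraMap R S),
        ∃ r : R, x - algebraMap R S r ∈ (I ^ (t + 1)).map (algebraMap R S) := by
      intro x hx
      refine Submodule.closure_induction (p := fun x _ ↦
        ∃ r : R, x - algebraMap R S r ∈ (I ^ (t + 1)).map (algebraMap R S)) ?_ ?_ ?_ hx
      · exact ⟨0, by simp⟩
      · rintro x y _ _ ⟨a, ha⟩ ⟨b, hb⟩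
        exact ⟨a + b, by rw [map_add, add_sub_add_comm]; exact add_mem ha hb⟩
      · rintro c _ ⟨a, ha, rfl⟩
        obtain ⟨r, hr⟩ := h c
        refine ⟨r * a, ?_⟩
        rw [map_mul, smul_eq_mul, ← sub_mul, pow_succ', Ideal.map_mul]
        exact Ideal.mul_mem_mul hr (Ideal.mem_map_of_mem _ ha)
    obtain ⟨r, hr⟩ := ih s
    obtain ⟨r', hr'⟩ := key _ hr
    exact ⟨r + r', by rwa [map_add, ← sub_sub]⟩

/-- If `S/J` is a simple `R`-module, then `S = R + J`. -/
theorem exists_sub_algebraMap_mem_of_isSimpleModule_quotient {R S : Type*} [CommRing R]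
    [CommRing S] [Algebra R S] (J : Ideal S) [IsSimpleModule R (S ⧸ J)] (s : S) :
    ∃ r : R, s - algebraMap R S r ∈ J := by
  have : Nontrivial (S ⧸ J) := IsSimpleModule.nontrivial R _
  obtain ⟨r, hr⟩ := IsSimpleModule.toSpanSingleton_surjective R (one_ne_zero (α := S ⧸ J))
    (Ideal.Quotient.mk J s)
  refine ⟨r, Ideal.Quotient.eq.mp ?_⟩
  rw [← hr, LinearMap.toSpanSingleton_apply, Algebra.smul_def, mul_one]
  rfl


open IsLocalRing TensorProduct CategoryTheory

/-- If the `R`-module `S/mS` has length `1`, then `mS = n` and for every `t > 0` the natural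
ring homomorphism `R/m^t → S/m^t S` is bijective. -/
theorem stmt13 (R S : Type*) [CommRing R] [CommRing S] [IsNoetherianRing R] [IsNoetherianRing S]
    [IsLocalRing R] [IsLocalRing S] [Algebra R S] [Module.Flat R S]
    [IsLocalHom (algebraMap R S)]
    (hlen : moduleLength R (S ⧸ (maximalIdeal R).map (algebraMap R S)) = 1) :
    (maximalIdeal R).map (algebraMap R S) = maximalIdeal S ∧
      ∀ t : ℕ, 0 < t →
        Function.Bijective (Ideal.quotientMap ((maximalIdeal R ^ t).map (algebraMap R S))
          (algebraMap R S) Ideal.le_comap_map) := by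
  have hsimple : IsSimpleModule R (S ⧸ (maximalIdeal R).map (algebraMap R S)) := by
    rw [← Module.length_eq_one_iff]
    rw [moduleLength, ← Module.coe_length] at hlen
    exact_mod_cast hlen
  have hsurj := exists_sub_algebraMap_mem_of_isSimpleModule_quotient (R := R)
    ((maximalIdeal R).map (algebraMap R S))
  have hle : (maximalIdeal R).map (algebraMap R S) ≤ maximalIdeal S :=
    ((local_hom_TFAE (algebraMap R S)).out 0 2).mp ‹IsLocalHom (algebraMap R S)›
  refine ⟨le_antisymm hle fun s hs ↦ ?_, fun t _ ↦ ⟨?_, ?_⟩⟩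
  · obtain ⟨r, hr⟩ := hsurj s
    have hrS : algebraMap R S r ∈ maximalIdeal S := by
      simpa using sub_mem hs (hle hr)
    have hrR : r ∈ maximalIdeal R := fun hu ↦ hrS (hu.map (algebraMap R S))
    simpa using add_mem hr (Ideal.mem_map_of_mem (algebraMap R S) hrR)
  · have : Module.FaithfullyFlat R S := Module.FaithfullyFlat.of_flat_of_isLocalHom
    exact Ideal.quotientMap_injective' (Ideal.comap_map_eq_self_of_faithfullyFlat _).le
  · intro y
    obtain ⟨s, rfl⟩ := Ideal.Quotient.mk_surjective y
    obtain ⟨r, hr⟩ := exists_sub_algebraMap_mem_map_pow hsurj t s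
    exact ⟨Ideal.Quotient.mk _ r, by
      rw [Ideal.quotientMap_mk]; exact (Ideal.Quotient.eq.mpr hr).symm⟩
end

section
/- Suppose the R-module S/mS has finite length m (a natural number). Then for every positive integer t, the R-module S/m^t S has finite length and ℓ_R(S/m^t S) = m · ℓ_R(R/m^t). -/
open IsLocalRing TensorProduct CategoryTheory

theorem coe_length_eq_moduleLength (R M : Type*) [Ring R] [AddCommGroup M] [Module R M] :
    (Module.length R M : WithBot ℕ∞) = moduleLength R M :=
  Module.coe_length R M

/-- For a flat local extension `S` of a local ring `R` and an ideal `I` of `R`,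
`ℓ_R(S/IS) = ℓ_R(R/I) * ℓ_R(S/mS)`, with values in `ℕ∞`. -/
theorem length_quotient_map_of_flat (R S : Type*) [CommRing R] [CommRing S]
    [IsLocalRing R] [IsLocalRing S] [Algebra R S] [Module.Flat R S]
    [IsLocalHom (algebraMap R S)] (I : Ideal R) :
    Module.length R (S ⧸ I.map (algebraMap R S)) =
      Module.length R (R ⧸ I) *
        Module.length R (S ⧸ (maximalIdeal R).map (algebraMap R S)) := by
  rw [IsLocalRing.length_restrictScalars R S (S ⧸ I.map (algebraMap R S)),
    IsLocalRing.length_restrictScalars R S (S ⧸ (maximalIdeal R).map (algebraMap R S)),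
    (Algebra.TensorProduct.quotIdealMapEquivTensorQuot S I).toLinearEquiv.length_eq,
    IsLocalRing.length_baseChange R S (R ⧸ I), mul_assoc]

theorem length_quotient_maximalIdeal_pow_ne_top (R : Type*) [CommRing R] [IsNoetherianRing R]
    [IsLocalRing R] {t : ℕ} (ht : 0 < t) :
    Module.length R (R ⧸ maximalIdeal R ^ t) ≠ ⊤ := by
  have hle : maximalIdeal R ^ t ≤ maximalIdeal R := Ideal.pow_le_self ht.ne'
  have : Nontrivial (R ⧸ maximalIdeal R ^ t) :=
    Ideal.Quotient.nontrivial_iff.mpr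
      (ne_top_of_le_ne_top (Ideal.IsPrime.ne_top inferInstance) hle)
  have : IsLocalRing (R ⧸ maximalIdeal R ^ t) :=
    .of_surjective' (Ideal.Quotient.mk _) Ideal.Quotient.mk_surjective
  have hmap : (maximalIdeal R).map (Ideal.Quotient.mk (maximalIdeal R ^ t)) =
      maximalIdeal (R ⧸ maximalIdeal R ^ t) :=
    IsLocalRing.map_maximalIdeal_of_surjective _ Ideal.Quotient.mk_surjective
  have : IsArtinianRing (R ⧸ maximalIdeal R ^ t) := by
    rw [isArtinianRing_iff_isNilpotent_maximalIdeal]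
    exact ⟨t, by rw [← hmap, ← Ideal.map_pow, Ideal.map_quotient_self, Ideal.zero_eq_bot]⟩
  rw [Module.length_eq_of_surjective (S := R) (R := R ⧸ maximalIdeal R ^ t)
    Ideal.Quotient.mk_surjective]
  exact Module.length_ne_top

/-- If the `R`-module `S/mS` has finite length `m`, then for every `t > 0` the `R`-module
`S/m^t S` has finite length and `ℓ_R(S/m^t S) = m * ℓ_R(R/m^t)`. -/
theorem stmt14 (R S : Type*) [CommRing R] [CommRing S] [IsNoetherianRing R] [IsNoetherianRing S]
    [IsLocalRing R] [IsLocalRing S] [Algebra R S] [Module.Flat R S]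
    [IsLocalHom (algebraMap R S)]
    (m : ℕ) (hlen : moduleLength R (S ⧸ (maximalIdeal R).map (algebraMap R S)) = (m : ℕ))
    (t : ℕ) (ht : 0 < t) :
    IsFiniteLength R (S ⧸ (maximalIdeal R ^ t).map (algebraMap R S)) ∧
      moduleLength R (S ⧸ (maximalIdeal R ^ t).map (algebraMap R S)) =
        (m : ℕ) * moduleLength R (R ⧸ maximalIdeal R ^ t) := by
  rw [← coe_length_eq_moduleLength] at hlen
  have hm : Module.length R (S ⧸ (maximalIdeal R).map (algebraMap R S)) = m := by
    exact_mod_cast hlen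
  have key := length_quotient_map_of_flat R S (maximalIdeal R ^ t)
  rw [hm, mul_comm] at key
  refine ⟨?_, ?_⟩
  · rw [← Module.length_ne_top_iff, key]
    exact WithTop.mul_ne_top (ENat.natCast_ne_top m) (length_quotient_maximalIdeal_pow_ne_top R ht)
  · rw [← coe_length_eq_moduleLength, ← coe_length_eq_moduleLength, key]
    exact WithBot.coe_mul _ _
end

section
/- Suppose the R-module S/mS has finite length m (a natural number). Then for every finitely generated R-module M and every natural number i, there is an R-linear isomorphism H^i_n(M ⊗_R S) ≅ (H^i_m(M))^m, where H^i_n(M ⊗_R S) is the i-th local cohomology of the S-module M ⊗_R S with respect to the ideal n, regarded as an R-module by restriction of scalars along φ, and (H^i_m(M))^m is the direct sum of m copies of the i-th local cohomology of M with respect to m. -/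
open IsLocalRing TensorProduct CategoryTheory

universe u

namespace CategoryTheory.Functor

open Limits

section

universe v₁ v₂ v₃ u₁ u₂ u₃

variable {C : Type u₁} [Category.{v₁} C] [Abelian C]
  {D : Type u₂} [Category.{v₂} D] [Abelian D]
  {E : Type u₃} [Category.{v₃} E] [Abelian E]

/-- A functor preserving homology commutes with the homology of complexes. -/
noncomputable def mapHomologicalComplexCompHomologyIso (F : D ⥤ E) [F.Additive]
    [F.PreservesHomology] {ι : Type*} (c : ComplexShape ι) (n : ι) :
    F.mapHomologicalComplex c ⋙ HomologicalComplex.homologyFunctor E c n ≅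
      HomologicalComplex.homologyFunctor D c n ⋙ F :=
  NatIso.ofComponents (fun K => (K.sc n).mapHomologyIso F)
    (fun f => ShortComplex.mapHomologyIso_hom_naturality
      ((HomologicalComplex.shortComplexFunctor D c n).map f) F)

lemma mapProjectiveResolution_π_f_zero (F : C ⥤ D) [F.Additive] [F.PreservesProjectiveObjects]
    [F.PreservesHomology] {X : C} (P : ProjectiveResolution X) :
    (F.mapProjectiveResolution P).π.f 0 = F.map (P.π.f 0) := by
  rw [mapProjectiveResolution_π, HomologicalComplex.comp_f]
  erw [HomologicalComplex.singleMapHomologicalComplex_hom_app_self]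
  exact (congrArg (F.map (P.π.f 0) ≫ ·) ((congrArg (· ≫ 𝟙 _) (F.map_id X)).trans
    (Category.comp_id _))).trans
    (Category.comp_id _)

variable [HasProjectiveResolutions C]

/-- Postcomposing with a functor preserving homology commutes with taking left derived functors. -/
noncomputable def leftDerivedCompIso (F : C ⥤ D) [F.Additive] (G : D ⥤ E) [G.Additive]
    [G.PreservesHomology] (n : ℕ) : (F ⋙ G).leftDerived n ≅ F.leftDerived n ⋙ G :=
  NatIso.ofComponents
    (fun X => (projectiveResolution X).isoLeftDerivedObj (F ⋙ G) n ≪≫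
      (G.mapHomologicalComplexCompHomologyIso _ n).app
        ((F.mapHomologicalComplex _).obj (projectiveResolution X).complex) ≪≫
      G.mapIso ((projectiveResolution X).isoLeftDerivedObj F n).symm)
    (fun {X Y} f => by
      let φ := ProjectiveResolution.lift f (projectiveResolution X) (projectiveResolution Y)
      have hφ : φ.f 0 ≫ (projectiveResolution Y).π.f 0 =
        (projectiveResolution X).π.f 0 ≫ f :=
        ProjectiveResolution.lift_commutes_zero _ _ _
      have h₁ := ProjectiveResolution.isoLeftDerivedObj_hom_naturality f
        (projectiveResolution X) (projectiveResolution Y) φ hφ (F ⋙ G) n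
      have h₂ := ProjectiveResolution.isoLeftDerivedObj_inv_naturality f
        (projectiveResolution X) (projectiveResolution Y) φ hφ F n
      have h₃ := (G.mapHomologicalComplexCompHomologyIso (ComplexShape.down ℕ) n).hom.naturality
        ((F.mapHomologicalComplex _).map φ)
      exact ((CommSq.mk h₁.symm).horiz_comp ((CommSq.mk h₃.symm).horiz_comp
        ((CommSq.mk h₂).map G))).w.symm)

/-- Precomposing with a functor preserving homology and projective objects commutes with taking
left derived functors. -/
noncomputable def compLeftDerivedIso {B : Type u₃} [Category.{v₃} B] [Abelian B]
    [HasProjectiveResolutions B] (G : B ⥤ C) [G.Additive] [G.PreservesHomology]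
    [G.PreservesProjectiveObjects] (F : C ⥤ D) [F.Additive] (n : ℕ) :
    (G ⋙ F).leftDerived n ≅ G ⋙ F.leftDerived n :=
  NatIso.ofComponents
    (fun X => (projectiveResolution X).isoLeftDerivedObj (G ⋙ F) n ≪≫
      ((G.mapProjectiveResolution (projectiveResolution X)).isoLeftDerivedObj F n).symm)
    (fun {X Y} f => by
      let φ := ProjectiveResolution.lift f (projectiveResolution X) (projectiveResolution Y)
      have hφ : φ.f 0 ≫ (projectiveResolution Y).π.f 0 =
        (projectiveResolution X).π.f 0 ≫ f :=
        ProjectiveResolution.lift_commutes_zero _ _ _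
      have h₁ := ProjectiveResolution.isoLeftDerivedObj_hom_naturality f
        (projectiveResolution X) (projectiveResolution Y) φ hφ (G ⋙ F) n
      have h₂ := ProjectiveResolution.isoLeftDerivedObj_inv_naturality (G.map f)
        (G.mapProjectiveResolution (projectiveResolution X))
        (G.mapProjectiveResolution (projectiveResolution Y)) ((G.mapHomologicalComplex _).map φ)
        (by
          rw [mapProjectiveResolution_π_f_zero, mapProjectiveResolution_π_f_zero]
          exact (G.map_comp _ _).symm.trans ((congrArg G.map hφ).trans (G.map_comp _ _))) F n
      exact ((CommSq.mk h₁.symm).horiz_comp (CommSq.mk h₂)).w.symm)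

/-- Isomorphic additive functors have isomorphic left derived functors. -/
noncomputable def leftDerivedIsoOfIso {F G : C ⥤ D} [F.Additive] [G.Additive] (e : F ≅ G) (n : ℕ) :
    F.leftDerived n ≅ G.leftDerived n where
  hom := NatTrans.leftDerived e.hom n
  inv := NatTrans.leftDerived e.inv n
  hom_inv_id := by rw [← NatTrans.leftDerived_comp, e.hom_inv_id, NatTrans.leftDerived_id]
  inv_hom_id := by rw [← NatTrans.leftDerived_comp, e.inv_hom_id, NatTrans.leftDerived_id]

lemma isIso_leftDerived_app {F G : C ⥤ D} [F.Additive] [G.Additive] (α : F ⟶ G) {X : C}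
    (P : ProjectiveResolution X) (h : ∀ i, IsIso (α.app (P.complex.X i))) (n : ℕ) :
    IsIso ((NatTrans.leftDerived α n).app X) := by
  rw [P.leftDerived_app_eq α n]
  have : IsIso ((NatTrans.mapHomologicalComplex α (ComplexShape.down ℕ)).app P.complex) := by
    have (i : ℕ) : IsIso (((NatTrans.mapHomologicalComplex α
      (ComplexShape.down ℕ)).app P.complex).f i) := h i
    exact HomologicalComplex.Hom.isIso_of_components _
  infer_instance

/-- Left derived functors are compatible with endomorphisms of the identity functor, such as
scalar multiplications. -/
lemma leftDerived_map_app (F : C ⥤ D) [F.Additive] (σ : 𝟭 C ⟶ 𝟭 C) (τ : 𝟭 D ⟶ 𝟭 D)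
    (h : ∀ X, F.map (σ.app X) = τ.app (F.obj X)) (n : ℕ) (X : C) :
    (F.leftDerived n).map (σ.app X) = τ.app ((F.leftDerived n).obj X) := by
  let P := projectiveResolution X
  let φ : P.complex ⟶ P.complex :=
    { f := fun i => σ.app _
      comm' := fun i j _ => (σ.naturality (P.complex.d i j)).symm }
  rw [← cancel_mono (P.isoLeftDerivedObj F n).hom,
    P.isoLeftDerivedObj_hom_naturality (σ.app X) P φ (σ.naturality _).symm F n]
  have key := τ.naturality (P.isoLeftDerivedObj F n).hom
  dsimp only [Functor.id_map, Functor.id_obj] at key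
  rw [← key]
  congr 1
  set K := (F.mapHomologicalComplex (ComplexShape.down ℕ)).obj P.complex
  change HomologicalComplex.homologyMap ((F.mapHomologicalComplex _).map φ) n =
    τ.app (K.homology n)
  rw [← cancel_epi (K.homologyπ n), HomologicalComplex.homologyπ_naturality]
  have h₁ := τ.naturality (K.homologyπ n)
  have h₂ := τ.naturality (K.iCycles n)
  dsimp only [Functor.id_map, Functor.id_obj] at h₁ h₂
  rw [h₁]
  congr 1
  rw [← cancel_mono (K.iCycles n), HomologicalComplex.cyclesMap_i, ← h₂]
  congr 1
  exact h _

end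

end CategoryTheory.Functor

namespace ModuleCat

open Limits

section BaseChange

variable {R S : Type u} [CommRing R] [CommRing S] (f : R →+* S)

/-- Restricting the `S`-module structure on `N` to `R` recovers the given `R`-module structure. -/
noncomputable def restrictScalarsOfAlgebraIso (R : Type u) {S : Type u} [CommRing R] [CommRing S]
    [Algebra R S] (N : Type u) [AddCommGroup N] [Module R N] [Module S N] [IsScalarTower R S N] :
    (restrictScalars (algebraMap R S)).obj (of S N) ≅ of R N :=
  let e : (restrictScalars (algebraMap R S)).obj (of S N) ≃ₗ[R] of R N :=
    { toFun := fun x => x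
      invFun := fun x => x
      left_inv := fun _ => rfl
      right_inv := fun _ => rfl
      map_add' := fun _ _ => rfl
      map_smul' := fun r (x : N) => algebraMap_smul S r x }
  e.toModuleIso

instance extendScalars_additive : (extendScalars.{u, u, u} f).Additive where
  map_add := by
    intro X Y g h
    refine ModuleCat.hom_ext (LinearMap.ext fun x => ?_)
    exact LinearMap.congr_fun (LinearMap.lTensor_add _ g.hom h.hom) x

lemma extendScalars_preservesFiniteLimits
    (h : Module.Flat R ((restrictScalars f).obj (of S S))) :
    PreservesFiniteLimits (extendScalars.{u, u, u} f) := by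
  refine (((Functor.exact_tfae (extendScalars.{u, u, u} f)).out 1 3 :).mp fun C hC => ?_).1
  rw [ShortComplex.ShortExact.moduleCat_exact_iff_function_exact] at hC ⊢
  have : Function.Exact (C.f.hom.lTensor ((restrictScalars f).obj (of S S)))
      (C.g.hom.lTensor ((restrictScalars f).obj (of S S))) :=
    Module.Flat.lTensor_exact ((restrictScalars f).obj (of S S)) hC
  exact this

instance extendScalars_preservesProjectiveObjects :
    (extendScalars.{u, u, u} f).PreservesProjectiveObjects :=
  Functor.preservesProjectiveObjects_of_adjunction_of_preservesEpimorphisms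
    (extendRestrictScalarsAdj f)

/-- The additive functor `N ↦ Hom(N, Y)`. -/
noncomputable abbrev homFunctor {R : Type u} [CommRing R] (Y : ModuleCat.{u} R) :
    ModuleCat.{u} R ⥤ (ModuleCat.{u} R)ᵒᵖ :=
  ((linearYoneda R (ModuleCat.{u} R)).obj Y).rightOp

/-- The adjunction between extension and restriction of scalars, as an isomorphism of functors of
the first variable. -/
noncomputable def extendScalarsCompHomFunctorIso (Y : ModuleCat.{u} S) :
    extendScalars.{u, u, u} f ⋙ homFunctor Y ⋙ (restrictScalars f).op ≅
      homFunctor ((restrictScalars f).obj Y) :=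
  (NatIso.ofComponents (fun N =>
    let e : (restrictScalars f).obj (of S ((extendScalars f).obj N ⟶ Y)) ≃ₗ[R]
        of R (N ⟶ (restrictScalars f).obj Y) :=
      { (extendRestrictScalarsAdj f).homAddEquiv N Y with
        map_smul' := fun r g => rfl }
    e.toModuleIso.op)
    (fun {N N'} g => by
      apply Quiver.Hom.unop_inj
      refine ModuleCat.hom_ext (LinearMap.ext fun x => ?_)
      exact ((extendRestrictScalarsAdj f).homEquiv_naturality_left g x).symm)).symm

/-- The canonical map from the scalar extension of `R ⧸ I` to `S ⧸ IS`. -/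
noncomputable def extendScalarsQuotientHom (I : Ideal R) (K : Ideal S) (h : I.map f = K) :
    (extendScalars.{u, u, u} f).obj (of R (R ⧸ I)) ⟶ of S (S ⧸ K) :=
  ((extendRestrictScalarsAdj f).homEquiv (of R (R ⧸ I)) (of S (S ⧸ K))).symm
    (ofHom (Y := (restrictScalars f).obj (of S (S ⧸ K)))
      (I.liftQ
        { toFun := fun r => (Ideal.Quotient.mk K (f r) : S ⧸ K)
          map_add' := fun x y =>
            (congrArg (Ideal.Quotient.mk K) (map_add f x y)).trans (map_add _ _ _)
          map_smul' := fun r x =>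
            (congrArg (Ideal.Quotient.mk K) (map_mul f r x)).trans (map_mul _ _ _) }
        (fun x hx => by
          exact Ideal.Quotient.eq_zero_iff_mem.2 (h ▸ Ideal.mem_map_of_mem f hx))))

lemma extendScalarsQuotientHom_unit_apply (I : Ideal R) (K : Ideal S) (h : I.map f = K) (r : R) :
    extendScalarsQuotientHom f I K h ((extendRestrictScalarsAdj f).unit.app (of R (R ⧸ I))
      (Ideal.Quotient.mk I r)) = Ideal.Quotient.mk K (f r) := by
  have := ((extendRestrictScalarsAdj f).homEquiv (of R (R ⧸ I)) (of S (S ⧸ K))).apply_symm_apply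
    (ofHom (Y := (restrictScalars f).obj (of S (S ⧸ K)))
      (I.liftQ
        { toFun := fun r => (Ideal.Quotient.mk K (f r) : S ⧸ K)
          map_add' := fun x y =>
            (congrArg (Ideal.Quotient.mk K) (map_add f x y)).trans (map_add _ _ _)
          map_smul' := fun r x =>
            (congrArg (Ideal.Quotient.mk K) (map_mul f r x)).trans (map_mul _ _ _) }
        (fun x hx => by
          exact Ideal.Quotient.eq_zero_iff_mem.2 (h ▸ Ideal.mem_map_of_mem f hx))))
  exact LinearMap.congr_fun (congrArg ModuleCat.Hom.hom this) (Ideal.Quotient.mk I r)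

/-- The canonical map from `S ⧸ IS` to the scalar extension of `R ⧸ I`. -/
noncomputable def quotientToExtendScalars (I : Ideal R) (K : Ideal S) (h : I.map f = K) :
    of S (S ⧸ K) ⟶ (extendScalars.{u, u, u} f).obj (of R (R ⧸ I)) :=
  let N := (extendScalars.{u, u, u} f).obj (of R (R ⧸ I))
  let n : N := (extendRestrictScalarsAdj f).unit.app (of R (R ⧸ I)) (1 : R ⧸ I)
  ofHom (Y := N) (K.liftQ (LinearMap.toSpanSingleton S N n) (by
      rw [← h, Ideal.map_le_iff_le_comap]
      intro x hx
      have h₁ : f x • n = (extendRestrictScalarsAdj f).unit.app (of R (R ⧸ I))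
        (x • (1 : R ⧸ I)) := (map_smul ((extendRestrictScalarsAdj f).unit.app (of R (R ⧸ I))).hom
          x (1 : R ⧸ I)).symm
      have h₂ : x • (1 : R ⧸ I) = 0 :=
        (mul_one (Ideal.Quotient.mk I x)).trans (Ideal.Quotient.eq_zero_iff_mem.2 hx)
      rw [h₂] at h₁
      exact h₁.trans (map_zero ((extendRestrictScalarsAdj f).unit.app (of R (R ⧸ I))).hom)))

/-- Extending the scalars of `R ⧸ I` gives `S ⧸ IS`. -/
noncomputable def extendScalarsQuotientIso (I : Ideal R) (K : Ideal S) (h : I.map f = K) :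
    (extendScalars.{u, u, u} f).obj (of R (R ⧸ I)) ≅ of S (S ⧸ K) where
  hom := extendScalarsQuotientHom f I K h
  inv := quotientToExtendScalars f I K h
  hom_inv_id := by
    refine ExtendScalars.hom_ext fun x => ?_
    obtain ⟨x, rfl⟩ := Ideal.Quotient.mk_surjective x
    refine (congrArg (quotientToExtendScalars f I K h)
      (extendScalarsQuotientHom_unit_apply f I K h x)).trans ?_
    refine (map_smul ((extendRestrictScalarsAdj f).unit.app (of R (R ⧸ I))).hom
          x (1 : R ⧸ I)).symm.trans ?_
    exact congrArg ((extendRestrictScalarsAdj f).unit.app (of R (R ⧸ I)))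
      (mul_one (Ideal.Quotient.mk I x))
  inv_hom_id := by
    refine ModuleCat.hom_ext (Submodule.linearMap_qext _ (LinearMap.ext_ring ?_))
    have := extendScalarsQuotientHom_unit_apply f I K h 1
    rw [map_one f] at this
    refine (congrArg (extendScalarsQuotientHom f I K h) (one_smul S _)).trans this

/-- Extension of scalars takes the system `R ⧸ J ^ t` to the system `S ⧸ (JS) ^ t`. -/
noncomputable def ringModIdealsCompExtendScalarsIso (J : Ideal R) :
    localCohomology.ringModIdeals (localCohomology.idealPowersDiagram J) ⋙
      extendScalars.{u, u, u} f ≅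
      localCohomology.ringModIdeals (localCohomology.idealPowersDiagram (J.map f)) :=
  NatIso.ofComponents (fun t => extendScalarsQuotientIso f _ _ (Ideal.map_pow f J t.unop))
    (fun {s t} g => by
      refine ExtendScalars.hom_ext fun x => ?_
      obtain ⟨x, rfl⟩ := Ideal.Quotient.mk_surjective x
      refine (extendScalarsQuotientHom_unit_apply f _ _ (Ideal.map_pow f J t.unop) x).trans ?_
      exact (congrArg ((localCohomology.ringModIdeals
        (localCohomology.idealPowersDiagram (J.map f))).map g)
        (extendScalarsQuotientHom_unit_apply f _ _ (Ideal.map_pow f J s.unop) x)).symm)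

end BaseChange

open localCohomology

section

variable {R S : Type u} [CommRing R] [CommRing S] (f : R →+* S)

/-- The direct system of the modules `Ext^n(R ⧸ J ^ t, Y)`. -/
noncomputable abbrev extSystem (J : Ideal R) (n : ℕ) (Y : ModuleCat.{u} R) :
    ℕᵒᵖᵒᵖ ⥤ ModuleCat.{u} R :=
  (ringModIdeals (idealPowersDiagram J) ⋙ (homFunctor Y).leftDerived n).leftOp

/-- Local cohomology is the colimit of the modules `Ext^n(R ⧸ J ^ t, Y)`. -/
noncomputable def localCohomologyObjIso (J : Ideal R) (n : ℕ) (Y : ModuleCat.{u} R) :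
    (localCohomology J n).obj Y ≅ colimit (extSystem J n Y) :=
  colimitObjIsoColimitCompEvaluation (diagram (idealPowersDiagram J) n) Y

/-- `Ext_S(N ⊗ S, Y)` is `Ext_R(N, Y)` for flat `S`, naturally in `N`. -/
noncomputable def extendScalarsCompLeftDerivedIso
    (h : Module.Flat R ((restrictScalars f).obj (of S S))) (n : ℕ) (Y : ModuleCat.{u} S) :
    extendScalars.{u, u, u} f ⋙ (homFunctor Y).leftDerived n ⋙ (restrictScalars f).op ≅
      (homFunctor ((restrictScalars f).obj Y)).leftDerived n :=
  have := extendScalars_preservesFiniteLimits f h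
  Functor.isoWhiskerLeft _ (Functor.leftDerivedCompIso (homFunctor Y) (restrictScalars f).op n).symm
    ≪≫ (Functor.compLeftDerivedIso (extendScalars.{u, u, u} f)
      (homFunctor Y ⋙ (restrictScalars f).op) n).symm ≪≫
    Functor.leftDerivedIsoOfIso (extendScalarsCompHomFunctorIso f Y) n

/-- Flat base change for the systems computing local cohomology. -/
noncomputable def extSystemCompRestrictScalarsIso
    (h : Module.Flat R ((restrictScalars f).obj (of S S)))
    (J : Ideal R) (n : ℕ) (Y : ModuleCat.{u} S) :
    extSystem (J.map f) n Y ⋙ restrictScalars f ≅ extSystem J n ((restrictScalars f).obj Y) :=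
  let e : ringModIdeals (idealPowersDiagram (J.map f)) ⋙ (homFunctor Y).leftDerived n ⋙
      (restrictScalars f).op ≅
      ringModIdeals (idealPowersDiagram J) ⋙
        (homFunctor ((restrictScalars f).obj Y)).leftDerived n :=
    (Functor.isoWhiskerRight (ringModIdealsCompExtendScalarsIso f J)
      ((homFunctor Y).leftDerived n ⋙ (restrictScalars f).op)).symm ≪≫
    Functor.isoWhiskerLeft (ringModIdeals (idealPowersDiagram J))
      (extendScalarsCompLeftDerivedIso f h n Y)
  NatIso.ofComponents (fun t => (e.app t.unop).unop.symm) (fun {s t} g => by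
    exact Quiver.Hom.op_inj (e.inv.naturality g.unop).symm)

/-- Flat base change for local cohomology. -/
noncomputable def restrictScalarsLocalCohomologyIso
    (h : Module.Flat R ((restrictScalars f).obj (of S S)))
    (J : Ideal R) (n : ℕ) (Y : ModuleCat.{u} S) :
    (restrictScalars f).obj ((localCohomology (J.map f) n).obj Y) ≅
      colimit (extSystem J n ((restrictScalars f).obj Y)) :=
  (restrictScalars f).mapIso (localCohomologyObjIso (J.map f) n Y) ≪≫
    preservesColimitIso (restrictScalars f) (extSystem (J.map f) n Y) ≪≫
    HasColimit.isoOfNatIso (extSystemCompRestrictScalarsIso f h J n Y)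

end

end ModuleCat

namespace FGModuleCat

open Limits

lemma exists_epi_of_free {R : Type u} [CommRing R] [IsNoetherianRing R] (M : FGModuleCat.{u} R) :
    ∃ (n : ℕ) (g : FGModuleCat.of R (Fin n → R) ⟶ M), Epi g := by
  obtain ⟨n, g, hg⟩ := Module.Finite.exists_fin' R M
  refine ⟨n, FGModuleCat.ofHom g, ?_⟩
  apply (forget₂ (FGModuleCat.{u} R) (ModuleCat.{u} R)).epi_of_epi_map
  exact (ModuleCat.epi_iff_surjective _).2 hg

variable (R : Type u) [CommRing R] [IsNoetherianRing R]

instance projective_of_free (n : ℕ) : Projective (FGModuleCat.of R (Fin n → R)) := by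
  have : Projective ((forget₂ (FGModuleCat.{u} R) (ModuleCat.{u} R)).obj
      (FGModuleCat.of R (Fin n → R))) :=
    ModuleCat.projective_of_free (M := ModuleCat.of R (Fin n → R)) (Pi.basisFun R (Fin n))
  exact (forget₂ (FGModuleCat.{u} R) (ModuleCat.{u} R)).projective_of_map_projective this

instance enoughProjectives : EnoughProjectives (FGModuleCat.{u} R) where
  presentation M := by
    obtain ⟨n, g, hg⟩ := exists_epi_of_free M
    exact ⟨{ p := FGModuleCat.of R (Fin n → R), f := g }⟩

instance forget₂_preservesProjectiveObjects :
    (forget₂ (FGModuleCat.{u} R) (ModuleCat.{u} R)).PreservesProjectiveObjects where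
  projective_obj {M} hM := by
    obtain ⟨n, g, hg⟩ := exists_epi_of_free M
    have : Projective ((forget₂ (FGModuleCat.{u} R) (ModuleCat.{u} R)).obj
      (FGModuleCat.of R (Fin n → R))) :=
      ModuleCat.projective_of_free (M := ModuleCat.of R (Fin n → R)) (Pi.basisFun R (Fin n))
    exact Retract.projective
      (((⟨Projective.factorThru (𝟙 M) g, g, Projective.factorThru_comp _ _⟩ : Retract M _)).map
        (forget₂ (FGModuleCat.{u} R) (ModuleCat.{u} R)))

end FGModuleCat

namespace ModuleCat

open Limits MonoidalCategory

variable {R : Type u} [CommRing R]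

/-- A finitely generated module over a Noetherian ring has a resolution by finitely generated
projective modules. -/
lemma exists_projectiveResolution_finite [IsNoetherianRing R] (N : Type u) [AddCommGroup N]
    [Module R N] [Module.Finite R N] :
    ∃ P : ProjectiveResolution (of R N), ∀ i, Module.Finite R (P.complex.X i) :=
  ⟨(forget₂ (FGModuleCat.{u} R) (ModuleCat.{u} R)).mapProjectiveResolution
    (CategoryTheory.projectiveResolution (FGModuleCat.of R N)), fun i =>
      inferInstanceAs (Module.Finite R
        ((CategoryTheory.projectiveResolution (FGModuleCat.of R N)).complex.X i))⟩

/-- The canonical maps `F ⊗ Hom(N, M) ⟶ Hom(N, F ⊗ M)`. -/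
noncomputable def homFunctorTensorNatTrans (F M : ModuleCat.{u} R) :
    homFunctor (F ⊗ M) ⟶ homFunctor M ⋙ (tensorLeft F).op where
  app N := Quiver.Hom.op (ofHom (X := F ⊗[R] (N ⟶ M)) (Y := N ⟶ F ⊗ M)
    ((ModuleCat.homLinearEquiv (S := R) (M := N) (N := F ⊗ M)).symm.toLinearMap ∘ₗ
      lTensorHomToHomLTensor (.id R) N F M ∘ₗ
        (ModuleCat.homLinearEquiv (S := R) (M := N) (N := M)).toLinearMap.lTensor F))
  naturality N N' g := by
    apply Quiver.Hom.unop_inj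
    refine ModuleCat.hom_ext (TensorProduct.ext' fun x h => ?_)
    refine ModuleCat.hom_ext (LinearMap.ext fun n => ?_)
    rfl

lemma isIso_homFunctorTensorNatTrans_app (F M P : ModuleCat.{u} R) [Projective P]
    [Module.Finite R P] : IsIso ((homFunctorTensorNatTrans F M).app P) := by
  have : Module.Projective R P := P.projective_of_module_projective
  let e : F ⊗[R] (P ⟶ M) ≃ₗ[R] (P ⟶ F ⊗ M) :=
    (ModuleCat.homLinearEquiv (S := R) (M := P) (N := M)).lTensor F ≪≫ₗ
      lTensorHomEquivHomLTensor R P F M ≪≫ₗ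
        (ModuleCat.homLinearEquiv (S := R) (M := P) (N := F ⊗ M)).symm
  have he : ((homFunctorTensorNatTrans F M).app P).unop = (e.toModuleIso (X₁ := F ⊗[R] (P ⟶ M))
      (X₂ := (P ⟶ F ⊗ M))).hom :=
    ModuleCat.hom_ext (LinearMap.ext fun x => congrArg
      (ModuleCat.homLinearEquiv (S := R) (M := P) (N := F ⊗ M)).symm
      (lTensorHomEquivHomLTensor_apply _).symm)
  have : IsIso ((homFunctorTensorNatTrans F M).app P).unop := by
    rw [he]
    exact (e.toModuleIso (X₁ := F ⊗[R] (P ⟶ M)) (X₂ := (P ⟶ F ⊗ M))).isIso_hom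
  exact by rwa [isIso_unop_iff] at this

/-- For flat `F`, the modules `Ext(N, F ⊗ M)` and `F ⊗ Ext(N, M)` are isomorphic, naturally in the
finitely generated module `N`. -/
noncomputable def extSystemTensorIso [IsNoetherianRing R] (F M : ModuleCat.{u} R)
    [Module.Flat R F] (J : Ideal R) (n : ℕ) :
    extSystem J n (F ⊗ M) ≅ extSystem J n M ⋙ tensorLeft F :=
  let K := localCohomology.ringModIdeals (localCohomology.idealPowersDiagram J)
  let α := Functor.whiskerLeft K (NatTrans.leftDerived (homFunctorTensorNatTrans F M) n)
  have (t : _) : IsIso (α.app t) := by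
    obtain ⟨P, hP⟩ := exists_projectiveResolution_finite (R := R) (R ⧸ J ^ t.unop)
    exact Functor.isIso_leftDerived_app (homFunctorTensorNatTrans F M) P
      (fun i => have := P.projective i; isIso_homFunctorTensorNatTrans_app F M (P.complex.X i)) n
  have : IsIso α := NatIso.isIso_of_isIso_app α
  have := preservesFiniteLimits_op (tensorLeft F)
  have := preservesFiniteColimits_op (tensorLeft F)
  let e : K ⋙ (homFunctor (F ⊗ M)).leftDerived n ≅
      K ⋙ (homFunctor M).leftDerived n ⋙ (tensorLeft F).op :=
    asIso α ≪≫ Functor.isoWhiskerLeft K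
      (Functor.leftDerivedCompIso (homFunctor M) (tensorLeft F).op n)
  NatIso.ofComponents (fun t => (e.app t.unop).unop.symm) (fun {s t} g => by
    exact Quiver.Hom.op_inj (e.inv.naturality g.unop).symm)

end ModuleCat

section LocalAlgebra

variable {R S : Type u} [CommRing R] [CommRing S] [IsLocalRing R] [IsLocalRing S] [Algebra R S]
    [IsLocalHom (algebraMap R S)]

/-- If `S ⧸ mS` has finite length, then `mS` is primary to the maximal ideal of `S`. -/
lemma IsLocalRing.radical_map_maximalIdeal_eq
    (h : Module.length R (S ⧸ (maximalIdeal R).map (algebraMap R S)) ≠ ⊤) :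
    ((maximalIdeal R).map (algebraMap R S)).radical = (maximalIdeal S).radical := by
  rw [Module.length_ne_top_iff, isFiniteLength_iff_isNoetherian_isArtinian] at h
  have hart := h.2
  have hle : (maximalIdeal R).map (algebraMap R S) ≤ maximalIdeal S :=
    ((local_hom_TFAE (algebraMap R S)).out 0 2 :).1 inferInstance
  refine le_antisymm (Ideal.radical_mono hle) ?_
  rw [(maximalIdeal.isMaximal S).isPrime.radical, Ideal.radical_eq_sInf]
  refine le_sInf fun P ⟨hP, hPp⟩ => ?_
  have : IsArtinian R (S ⧸ P) := isArtinian_of_surjective (R := R)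
    (S ⧸ (maximalIdeal R).map (algebraMap R S))
    (Ideal.Quotient.factorₐ R hP).toLinearMap (Ideal.Quotient.factor_surjective hP)
  have : IsArtinianRing (S ⧸ P) := isArtinian_of_tower R this
  have : P.IsMaximal := Ideal.Quotient.maximal_of_isField _
    (IsArtinianRing.isField_of_isDomain _)
  exact (eq_maximalIdeal this).ge

/-- A `k`-basis of `S ⧸ mS` lifts to a linear map from a free module which becomes bijective modulo
`m`. -/
lemma IsLocalRing.exists_lTensor_bijective (m : ℕ)
    (h : Module.length R (S ⧸ (maximalIdeal R).map (algebraMap R S)) = m) :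
    ∃ f : (Fin m → R) →ₗ[R] S, Function.Bijective (f.lTensor (ResidueField R)) := by
  let e : (S ⧸ (maximalIdeal R).map (algebraMap R S)) ≃ₗ[R] ResidueField R ⊗[R] S :=
    (Algebra.TensorProduct.quotIdealMapEquivTensorQuot S
      (maximalIdeal R)).toLinearEquiv.restrictScalars R ≪≫ₗ TensorProduct.comm R S _
  rw [e.length_eq, Module.length_eq_of_surjective (R := ResidueField R) residue_surjective] at h
  have : Module.Finite (ResidueField R) (ResidueField R ⊗[R] S) := by
    have hf : IsFiniteLength (ResidueField R) (ResidueField R ⊗[R] S) := by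
      rw [← Module.length_ne_top_iff, h]
      exact ENat.natCast_ne_top m
    have := (isFiniteLength_iff_isNoetherian_isArtinian.1 hf).1
    infer_instance
  rw [Module.length_eq_finrank, Nat.cast_inj] at h
  let b := Module.finBasisOfFinrankEq _ _ h
  have hsurj (x : ResidueField R ⊗[R] S) : ∃ s : S, (1 : ResidueField R) ⊗ₜ[R] s = x :=
    TensorProduct.mk_surjective R S _ residue_surjective x
  choose s hs using fun i => hsurj (b i)
  let f : (Fin m → R) →ₗ[R] S := Fintype.linearCombination R s
  refine ⟨f, ?_⟩
  have key : (f.baseChange (ResidueField R)) =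
      (TensorProduct.piScalarRight R (ResidueField R) (ResidueField R) (Fin m) ≪≫ₗ
        b.equivFun.symm).toLinearMap := by
    ext i
    simp [f, hs, Pi.single_apply, Fintype.linearCombination_apply]
  have : ⇑(f.lTensor (ResidueField R)) = ⇑(f.baseChange (ResidueField R)) := rfl
  rw [this, key]
  exact LinearEquiv.bijective _

end LocalAlgebra

section

variable {R : Type u} [CommRing R]

lemma LinearMap.lTensor_bijective_of_smul_eq_zero {F₁ F₂ : Type u} [AddCommGroup F₁]
    [AddCommGroup F₂] [Module R F₁] [Module R F₂] (f : F₁ →ₗ[R] F₂)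
    {J : Ideal R} (hf : Function.Bijective (f.lTensor (R ⧸ J))) {E : Type u} [AddCommGroup E]
    [Module R E] (hE : ∀ a ∈ J, ∀ x : E, a • x = 0) : Function.Bijective (f.lTensor E) := by
  have hbot : J • (⊤ : Submodule R E) = ⊥ :=
    (Submodule.smul_le.2 fun a ha x _ => (Submodule.mem_bot R).2 (hE a ha x)).antisymm bot_le
  let e : E ≃ₗ[R] E ⊗[R] (R ⧸ J) := (TensorProduct.tensorQuotEquivQuotSMul E J ≪≫ₗ
    Submodule.quotEquivOfEqBot _ hbot).symm
  have h₁ : Function.Bijective (f.lTensor (E ⊗[R] (R ⧸ J))) := by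
    rw [LinearMap.lTensor_tensor]
    exact (TensorProduct.assoc R E (R ⧸ J) F₁ ≪≫ₗ (LinearEquiv.ofBijective _ hf).lTensor E ≪≫ₗ
      (TensorProduct.assoc R E (R ⧸ J) F₂).symm).bijective
  have h₂ : f.lTensor E = (e.symm.rTensor F₂).toLinearMap ∘ₗ
      f.lTensor (E ⊗[R] (R ⧸ J)) ∘ₗ (e.rTensor F₁).toLinearMap := by
    refine TensorProduct.ext' fun x y => ?_
    simp
  rw [h₂]
  exact (e.symm.rTensor F₂).bijective.comp (h₁.comp (e.rTensor F₁).bijective)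

lemma LinearMap.lTensor_bijective_of_pow_smul_eq_zero {F₁ F₂ : Type u} [AddCommGroup F₁]
    [AddCommGroup F₂] [Module R F₁] [Module R F₂] [Module.Flat R F₁] [Module.Flat R F₂]
    (f : F₁ →ₗ[R] F₂) {J : Ideal R} (hf : Function.Bijective (f.lTensor (R ⧸ J))) (t : ℕ)
    {E : Type u} [AddCommGroup E] [Module R E] (hE : ∀ a ∈ J ^ t, ∀ x : E, a • x = 0) :
    Function.Bijective (f.lTensor E) := by
  induction t generalizing E with
  | zero =>
    have : Subsingleton E := ⟨fun x y => by
      rw [← one_smul R x, ← one_smul R y, hE 1 (by simp), hE 1 (by simp)]⟩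
    have h₁ : Subsingleton (E ⊗[R] F₁) := inferInstance
    have h₂ : Subsingleton (E ⊗[R] F₂) := inferInstance
    exact ⟨fun _ _ _ => Subsingleton.elim _ _, fun x => ⟨0, Subsingleton.elim _ _⟩⟩
  | succ t ih =>
    let N : Submodule R E := J ^ t • ⊤
    have hN : Function.Bijective (f.lTensor N) := by
      refine lTensor_bijective_of_smul_eq_zero f hf fun a ha x => Subtype.ext ?_
      obtain ⟨x, hx⟩ := x
      change a • x = 0
      induction hx using Submodule.smul_induction_on' with
      | smul r hr n hn =>
        rw [← mul_smul]
        exact hE _ (pow_succ' J t ▸ Ideal.mul_mem_mul ha hr) n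
      | add x hx y hy h₁ h₂ => rw [smul_add, h₁, h₂, add_zero]
    have hQ : Function.Bijective (f.lTensor (E ⧸ N)) := by
      refine ih fun a ha x => ?_
      obtain ⟨x, rfl⟩ := N.mkQ_surjective x
      rw [← map_smul]
      exact (Submodule.Quotient.mk_eq_zero _).2
        (Submodule.smul_mem_smul ha Submodule.mem_top)
    have hex : Function.Exact N.subtype N.mkQ := LinearMap.exact_subtype_mkQ N
    exact bijective_of_surjective_of_bijective_of_bijective_of_injective
      (0 : Unit →ₗ[R] N ⊗[R] F₁) (N.subtype.rTensor F₁) (N.mkQ.rTensor F₁)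
      (0 : (E ⧸ N) ⊗[R] F₁ →ₗ[R] Unit)
      (0 : Unit →ₗ[R] N ⊗[R] F₂) (N.subtype.rTensor F₂) (N.mkQ.rTensor F₂)
      (0 : (E ⧸ N) ⊗[R] F₂ →ₗ[R] Unit)
      0 (f.lTensor N) (f.lTensor E) (f.lTensor (E ⧸ N)) 0
      (by simp) (by simp) (by simp) (by simp)
      ((LinearMap.exact_zero_iff_injective _ _).2
        (Module.Flat.rTensor_preserves_injective_linearMap _ N.subtype_injective))
      (rTensor_exact F₁ hex N.mkQ_surjective)
      ((LinearMap.exact_zero_iff_surjective _ _).2 (rTensor_surjective F₁ N.mkQ_surjective))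
      ((LinearMap.exact_zero_iff_injective _ _).2
        (Module.Flat.rTensor_preserves_injective_linearMap _ N.subtype_injective))
      (rTensor_exact F₂ hex N.mkQ_surjective)
      ((LinearMap.exact_zero_iff_surjective _ _).2 (rTensor_surjective F₂ N.mkQ_surjective))
      (Function.surjective_to_subsingleton _) hN hQ (Function.injective_of_subsingleton _)

end

namespace ModuleCat

open Limits MonoidalCategory localCohomology

variable {R : Type u} [CommRing R]

/-- Multiplication by `a`, as an endomorphism of the identity functor. -/
def idSMul (a : R) : 𝟭 (ModuleCat.{u} R) ⟶ 𝟭 (ModuleCat.{u} R) where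
  app X := a • 𝟙 X

lemma smul_eq_zero_of_mem_pow (J : Ideal R) (n : ℕ) (M : ModuleCat.{u} R) (t : ℕᵒᵖᵒᵖ) (a : R)
    (ha : a ∈ J ^ t.unop.unop) (x : (extSystem J n M).obj t) : a • x = 0 := by
  have h := Functor.leftDerived_map_app (homFunctor M) (idSMul a)
    (NatTrans.op (idSMul a)) (fun X => Quiver.Hom.unop_inj (ModuleCat.hom_ext
      (LinearMap.ext fun (f : X ⟶ M) =>
        (Linear.smul_comp _ _ _ a (𝟙 X) f).trans (congrArg (a • ·) (Category.id_comp f)))))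
    n (of R (R ⧸ J ^ t.unop.unop))
  have h₀ : (idSMul a).app (of R (R ⧸ J ^ t.unop.unop)) = 0 := by
    refine ModuleCat.hom_ext (LinearMap.ext fun y => ?_)
    obtain ⟨y, rfl⟩ := Ideal.Quotient.mk_surjective y
    exact Ideal.Quotient.eq_zero_iff_mem.2 (Ideal.mul_mem_right y _ ha)
  have h₁ := Functor.leftDerived_map_app (homFunctor M) 0 0 (fun _ => Functor.map_zero _ _ _) n
    (of R (R ⧸ J ^ t.unop.unop))
  rw [h₀] at h
  exact (LinearMap.congr_fun (congrArg (fun f => f.unop.hom) (h.symm.trans h₁)) x)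

/-- A map of flat modules which is bijective modulo `J` induces an isomorphism after tensoring with
the `J`-power torsion modules `Ext^n(R ⧸ J ^ t, M)`. -/
noncomputable def extSystemTensorLeftIso {F₁ F₂ : ModuleCat.{u} R} [Module.Flat R F₁]
    [Module.Flat R F₂] (f : F₁ ⟶ F₂) (J : Ideal R)
    (hf : Function.Bijective (f.hom.lTensor (R ⧸ J))) (n : ℕ) (M : ModuleCat.{u} R) :
    extSystem J n M ⋙ tensorLeft F₁ ≅ extSystem J n M ⋙ tensorLeft F₂ :=
  let α := Functor.whiskerLeft (extSystem J n M) ((curriedTensor (ModuleCat.{u} R)).map f)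
  have (t : _) : IsIso (α.app t) := (ConcreteCategory.isIso_iff_bijective _).2 <|
    (LinearMap.lTensor_bij_iff_rTensor_bij ((extSystem J n M).obj t) f.hom).1 <|
      f.hom.lTensor_bijective_of_pow_smul_eq_zero hf t.unop.unop
        fun a ha x => smul_eq_zero_of_mem_pow J n M t a ha x
  have := NatIso.isIso_of_isIso_app α
  asIso α

end ModuleCat

/-- If the `R`-module `S/mS` has finite length `m`, then for every finitely generated
`R`-module `M` and every `i` there is an `R`-linear isomorphism
`H^i_n(M ⊗_R S) ≅ (H^i_m(M))^m`. -/
theorem stmt15 (R S : Type u) [CommRing R] [CommRing S] [IsNoetherianRing R] [IsNoetherianRing S]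
    [IsLocalRing R] [IsLocalRing S] [Algebra R S] [Module.Flat R S]
    [IsLocalHom (algebraMap R S)]
    (m : ℕ) (hlen : moduleLength R (S ⧸ (maximalIdeal R).map (algebraMap R S)) = (m : ℕ))
    (M : Type u) [AddCommGroup M] [Module R M] [Module.Finite R M] (i : ℕ) :
    Nonempty ((RestrictScalars R S
        ((localCohomology (maximalIdeal S) i).obj (ModuleCat.of S (S ⊗[R] M))))
      ≃ₗ[R] (Fin m → ((localCohomology (maximalIdeal R) i).obj (ModuleCat.of R M)))) := by
  have hlen' : Module.length R (S ⧸ (maximalIdeal R).map (algebraMap R S)) = m := by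
    rw [moduleLength, ← Module.coe_length] at hlen
    exact_mod_cast hlen
  have hrad := IsLocalRing.radical_map_maximalIdeal_eq (R := R) (S := S)
    (hlen' ▸ ENat.natCast_ne_top m)
  obtain ⟨f, hf⟩ := IsLocalRing.exists_lTensor_bijective (R := R) (S := S) m hlen'
  have hflat : Module.Flat R
      ((ModuleCat.restrictScalars (algebraMap R S)).obj (ModuleCat.of S S)) :=
    Module.Flat.of_linearEquiv (ModuleCat.restrictScalarsOfAlgebraIso R S).toLinearEquiv
  let H : ModuleCat.{u} R := (localCohomology (maximalIdeal R) i).obj (ModuleCat.of R M)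
  let G : ModuleCat.{u} R := ModuleCat.of R (Fin m → R)
  let e : (ModuleCat.restrictScalars (algebraMap R S)).obj
      ((localCohomology (maximalIdeal S) i).obj (ModuleCat.of S (S ⊗[R] M))) ≅
      MonoidalCategory.tensorObj G H :=
    (ModuleCat.restrictScalars (algebraMap R S)).mapIso
      ((localCohomology.isoOfSameRadical hrad.symm i).app _) ≪≫
    ModuleCat.restrictScalarsLocalCohomologyIso (algebraMap R S) hflat (maximalIdeal R) i _ ≪≫
    (ModuleCat.localCohomologyObjIso _ i _).symm ≪≫
    (localCohomology (maximalIdeal R) i).mapIso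
      (ModuleCat.restrictScalarsOfAlgebraIso R (S ⊗[R] M)) ≪≫
    ModuleCat.localCohomologyObjIso _ i _ ≪≫
    Limits.HasColimit.isoOfNatIso
      (ModuleCat.extSystemTensorIso (ModuleCat.of R S) (ModuleCat.of R M) (maximalIdeal R) i ≪≫
        (ModuleCat.extSystemTensorLeftIso (F₁ := G) (F₂ := ModuleCat.of R S) (ModuleCat.ofHom f)
          (maximalIdeal R) hf i (ModuleCat.of R M)).symm) ≪≫
    (preservesColimitIso (MonoidalCategory.tensorLeft G)
      (ModuleCat.extSystem (maximalIdeal R) i (ModuleCat.of R M))).symm ≪≫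
    (MonoidalCategory.tensorLeft G).mapIso (ModuleCat.localCohomologyObjIso _ i _).symm
  exact ⟨e.toLinearEquiv ≪≫ₗ TensorProduct.comm R (Fin m → R) H ≪≫ₗ
    TensorProduct.piScalarRight R R H (Fin m)⟩
end
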